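/- arXiv:2209.14580 — 4 statements merged into one kernel-verified Lean document; each statement's English description precedes it below -/
import Mathlib

section
/- Suppose p(a,x) is a hermitian d×d matrix-valued free polynomial in the freely noncommuting variables a_1,…,a_μ, x_1,…,x_μ. If p is convex in x, then there exist a hermitian d×d matrix-valued polynomial L(a,x) that is affine linear in the variables x, a positive integer N and an N×d matrix-valued polynomial Λ(a,x) that is homogeneous of degree one in the variables x, such that p(a,x) = L(a,x) + Λ(a,x)* Λ(a,x). In particular, p has degree at most two in x. -/
open Matrix ComplexOrder

abbrev FreeWord (μ : ℕ) := FreeMonoid (Fin μ ⊕ Fin μ)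

abbrev NCPoly (N d μ : ℕ) := FreeWord μ →₀ Matrix (Fin N) (Fin d) ℂ

noncomputable def wordEval {μ : ℕ} {k : Type*} [Fintype k] [DecidableEq k]
    (X Y : Fin μ → Matrix k k ℂ) (w : FreeWord μ) : Matrix k k ℂ :=
  (w.toList.map (Sum.elim X Y)).prod

noncomputable def polyEval {N d μ : ℕ} {k : Type*} [Fintype k] [DecidableEq k]
    (p : NCPoly N d μ) (X Y : Fin μ → Matrix k k ℂ) :
    Matrix (Fin N × k) (Fin d × k) ℂ :=
  p.sum fun w c => Matrix.kroneckerMap (· * ·) c (wordEval X Y w)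

noncomputable def polyStar {N d μ : ℕ} (p : NCPoly N d μ) : NCPoly d N μ :=
  Finsupp.mapDomain (fun w => FreeMonoid.ofList w.toList.reverse)
    (Finsupp.mapRange Matrix.conjTranspose (by simp) p)

noncomputable def polyMul {a b c μ : ℕ} (p : FreeWord μ →₀ Matrix (Fin a) (Fin b) ℂ)
    (q : FreeWord μ →₀ Matrix (Fin b) (Fin c) ℂ) :
    FreeWord μ →₀ Matrix (Fin a) (Fin c) ℂ :=
  p.sum fun u cu => q.sum fun v cv => Finsupp.single (u * v) (cu * cv)

def loewnerLE {k : Type*} [Fintype k] (A B : Matrix k k ℂ) : Prop := (B - A).PosSemidef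

noncomputable def kronId {k l : Type*} (d : ℕ) (V : Matrix k l ℂ) :
    Matrix (Fin d × k) (Fin d × l) ℂ :=
  Matrix.kroneckerMap (· * ·) (1 : Matrix (Fin d) (Fin d) ℂ) V

noncomputable def compress {μ : ℕ} {k l : Type*} [Fintype k] (V : Matrix k l ℂ)
    (X : Fin μ → Matrix k k ℂ) : Fin μ → Matrix l l ℂ :=
  fun i => Vᴴ * X i * V


/-- The degree of a word in the variables `a` (the number of letters `aᵢ`, encoded as
`Sum.inl`). -/
def degA {μ : ℕ} (w : FreeWord μ) : ℕ := (w.toList.filter Sum.isLeft).length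

/-- The degree of a word in the variables `x` (the number of letters `xⱼ`, encoded as
`Sum.inr`). -/
def degX {μ : ℕ} (w : FreeWord μ) : ℕ := (w.toList.filter Sum.isRight).length

/-- `p(a,x)` is convex in `x`: for each `n`, each hermitian tuple `A`, all hermitian tuples
`X, Y` and each `0 < t < 1`, `p(A, tX+(1-t)Y) ⪯ t p(A,X) + (1-t) p(A,Y)`. -/
def IsConvexInX {d μ : ℕ} (p : NCPoly d d μ) : Prop :=
  ∀ (n : ℕ) (A X Y : Fin μ → Matrix (Fin n) (Fin n) ℂ),
    (∀ i, (A i).IsHermitian) → (∀ i, (X i).IsHermitian) → (∀ i, (Y i).IsHermitian) →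
    ∀ t : ℝ, 0 < t → t < 1 →
    loewnerLE (polyEval p A (fun i => t • X i + (1 - t) • Y i))
      (t • polyEval p A X + (1 - t) • polyEval p A Y)


section Separation

theorem exists_pos_on_compact_neg_at {E : Type*} [NormedAddCommGroup E] [NormedSpace ℝ E]
    {K : Set E} (hK : IsCompact K) (hconv : Convex ℝ K) {f : E} (hf : f ≠ 0)
    (hray : ∀ s : ℝ, 0 ≤ s → s • f ∉ K) :
    ∃ l : E →L[ℝ] ℝ, (∀ x ∈ K, 0 < l x) ∧ l f < 0 := by
  obtain ⟨l, u, v, hlu, huv, hvl⟩ := geometric_hahn_banach_compact_closed hconv hK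
    (t := (fun s : ℝ => s • f) '' Set.Ici 0)
    ((convex_Ici 0).linear_image (LinearMap.toSpanSingleton ℝ E f))
    (isClosedMap_smul_left f _ isClosed_Ici)
    (by
      rw [Set.disjoint_right]
      rintro _ ⟨s, hs, rfl⟩
      exact hray s hs)
  have hv : v < 0 := by simpa using hvl _ ⟨0, by simp, rfl⟩
  have hlf : 0 ≤ l f := by
    by_contra! h
    have h1 := hvl _ ⟨v / l f, (div_pos_of_neg_of_neg hv h).le, rfl⟩
    simp [div_mul_cancel₀ _ h.ne] at h1
  obtain ⟨g, hg⟩ := SeparatingDual.exists_eq_one (R := ℝ) hf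
  obtain ⟨B, hB⟩ := hK.exists_bound_of_continuousOn (f := g) g.continuous.continuousOn
  refine ⟨-(l + (-u / (|B| + 1)) • g), fun x hx => ?_, ?_⟩
  · have h1 := hlu x hx
    have h2 := (hB x hx).trans (le_abs_self B)
    have h3 : g x ≤ |B| + 1 := by
      rw [Real.norm_eq_abs] at h2
      linarith [le_abs_self (g x)]
    have h4 : (-u / (|B| + 1)) * g x ≤ -u := by
      rw [div_mul_eq_mul_div, div_le_iff₀ (by positivity)]
      exact mul_le_mul_of_nonneg_left h3 (by linarith)
    simp
    linarith
  · have : 0 < -u / (|B| + 1) := div_pos (by linarith) (by positivity)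
    simp [hg]
    linarith

theorem exists_re_sum_mul_eq {κ : Type*} [Fintype κ] [DecidableEq κ] (l : (κ → ℂ) →L[ℝ] ℝ) :
    ∃ m : κ → ℂ, ∀ e, l e = (∑ k, m k * e k).re := by
  refine ⟨fun k => l (Pi.single k 1) - Complex.I * l (Pi.single k Complex.I), fun e => ?_⟩
  have he : e = ∑ k, ((e k).re • (Pi.single k (1 : ℂ) : κ → ℂ) +
      (e k).im • (Pi.single k Complex.I : κ → ℂ)) := by
    ext j
    simp [Finset.sum_apply, Pi.single_apply, Finset.sum_add_distrib]
  conv_lhs => rw [he]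
  simp [map_sum]
  exact Finset.sum_congr rfl fun k _ => by ring

end Separation

section SumOfSquares

variable {α : Type*} {N d : Type*} [Fintype N]

/-- The coefficient at the word `w` of the hermitian square `r* r`. -/
noncomputable def sqCoeff (r : List α → Matrix N d ℂ) (w : List α) : Matrix d d ℂ :=
  ∑ i ∈ Finset.range (w.length + 1), (r (w.take i).reverse)ᴴ * r (w.drop i)

theorem exists_sqCoeff_ne_zero [Fintype d] (deg : List α → ℕ)
    (deg_append : ∀ u v, deg (u ++ v) = deg u + deg v) (deg_reverse : ∀ u, deg u.reverse = deg u)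
    {r : List α → Matrix N d ℂ} (hfin : {u | r u ≠ 0}.Finite) (hr : ∃ u, r u ≠ 0) :
    ∃ u, r u ≠ 0 ∧ (∀ s, r s ≠ 0 → deg s ≤ deg u) ∧ sqCoeff r (u.reverse ++ u) ≠ 0 := by
  obtain ⟨u, hu, hmax⟩ := Finset.exists_max_image hfin.toFinset
    (fun u => toLex (deg u, u.length)) (by simpa [Set.Nonempty] using hr)
  simp only [Set.Finite.mem_toFinset, Set.mem_ofPred_eq, Prod.Lex.toLex_le_toLex] at hu hmax
  refine ⟨u, hu, fun s hs => by rcases hmax s hs with h | h <;> omega, ?_⟩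
  have : sqCoeff r (u.reverse ++ u) = (r u)ᴴ * r u := by
    rw [sqCoeff, Finset.sum_eq_single u.length]
    · simp
    · intro i hi hiu
      by_contra h
      have hd := congrArg deg (List.take_append_drop i (u.reverse ++ u))
      have hls : ((u.reverse ++ u).take i).reverse.length = i := by
        simp only [Finset.mem_range] at hi
        rw [List.length_reverse, List.length_take]
        omega
      have hlt := List.length_drop (i := i) (l := u.reverse ++ u)
      rw [deg_append, deg_append, deg_reverse, ← deg_reverse (List.take _ _)] at hd
      generalize ((u.reverse ++ u).take i).reverse = s at *
      generalize (u.reverse ++ u).drop i = t at *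
      have h1 := hmax s fun h0 => h (by simp [h0])
      have h2 := hmax t fun h0 => h (by simp [h0])
      simp only [List.length_append, List.length_reverse] at hlt
      omega
    · simp
  rw [this]
  simpa using hu

theorem sum_sum_append_eq [DecidableEq α] {M : Type*} [AddCommMonoid M] (S T : Finset (List α))
    (F : List α → List α → M) (hS : ∀ u v, u ∉ S → F u v = 0) (hT : ∀ u v, v ∉ T → F u v = 0)
    (w : List α) :
    ∑ u ∈ S, ∑ v ∈ T, (if u ++ v = w then F u v else 0) =
      ∑ i ∈ Finset.range (w.length + 1), F (w.take i) (w.drop i) := by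
  rw [← Finset.sum_product', ← Finset.sum_filter]
  symm
  apply Finset.sum_bij_ne_zero (fun i _ _ => (w.take i, w.drop i))
  · intro i _ h
    simp only [Finset.mem_filter, Finset.mem_product, List.take_append_drop, and_true]
    exact ⟨by_contra fun h' => h (hS _ _ h'), by_contra fun h' => h (hT _ _ h')⟩
  · intro i hi _ j hj _ h
    have := congrArg List.length (congrArg Prod.fst h)
    simp at this hi hj
    omega
  · rintro ⟨u, v⟩ h h'
    simp only [Finset.mem_filter] at h
    obtain ⟨-, rfl⟩ := h
    exact ⟨u.length, by simp, by simpa using h', by simp⟩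
  · intros; rfl

/-- The finite set of words of length at most `k`. -/
noncomputable def wordsLE (α : Type*) [Finite α] (k : ℕ) : Finset (List α) :=
  (List.finite_length_le α k).toFinset

theorem mem_wordsLE [Finite α] {k : ℕ} {w : List α} : w ∈ wordsLE α k ↔ w.length ≤ k := by
  simp [wordsLE]

/-- The coefficient at `w` of the polynomial with Gram matrix `G`. -/
noncomputable def gramCoeff [Finite α] [DecidableEq α] {D : ℕ}
    (G : Matrix (wordsLE α D × d) (wordsLE α D × d) ℂ) (w : List α) : Matrix d d ℂ :=
  Matrix.of fun a b => ∑ u : wordsLE α D, ∑ v : wordsLE α D,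
    if u.1.reverse ++ v.1 = w then G (u, a) (v, b) else 0

/-- The polynomial of degree at most `D` whose coefficients are the column blocks of `R`. -/
noncomputable def colPoly [Finite α] [DecidableEq α] {D : ℕ} (R : Matrix N (wordsLE α D × d) ℂ)
    (v : List α) : Matrix N d ℂ :=
  if h : v ∈ wordsLE α D then Matrix.of fun k b => R k (⟨v, h⟩, b) else 0

omit [Fintype N] in
theorem colPoly_ne_zero [Finite α] [DecidableEq α] {D : ℕ} {R : Matrix N (wordsLE α D × d) ℂ}
    {v : List α} (h : colPoly R v ≠ 0) : v.length ≤ D := by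
  by_contra hv
  exact h (dif_neg (by rwa [mem_wordsLE]))

theorem gramCoeff_conjTranspose_mul_self [Finite α] [DecidableEq α] {D : ℕ}
    (R : Matrix N (wordsLE α D × d) ℂ) (w : List α) :
    gramCoeff (Rᴴ * R) w = sqCoeff (colPoly R) w := by
  ext a b
  have h1 := sum_sum_append_eq (wordsLE α D) (wordsLE α D)
    (fun u v => ((colPoly R u.reverse)ᴴ * colPoly R v) a b)
    (fun u v hu => by simp [colPoly, mem_wordsLE.not.1 hu, mem_wordsLE])
    (fun u v hv => by simp [colPoly, hv]) w
  rw [sqCoeff, Matrix.sum_apply, ← h1]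
  rw [Finset.sum_nbij' (t := wordsLE α D) List.reverse List.reverse
    (g := fun u => ∑ v ∈ wordsLE α D, if u.reverse ++ v = w then
      ((colPoly R u)ᴴ * colPoly R v) a b else 0) (by simp [mem_wordsLE]) (by simp [mem_wordsLE])
      (by simp) (by simp) (by simp), ← Finset.sum_coe_sort]
  simp only [gramCoeff, Matrix.of_apply]
  refine Finset.sum_congr rfl fun u _ => ?_
  rw [← Finset.sum_coe_sort (wordsLE α D)]
  refine Finset.sum_congr rfl fun v _ => ?_
  simp [colPoly, Matrix.mul_apply]

/-- `gramCoeff` as a real linear map, recording the coefficients of words of length at most `k`. -/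
noncomputable def gramLinear [Finite α] [DecidableEq α] (D k : ℕ) :
    Matrix (wordsLE α D × d) (wordsLE α D × d) ℂ →ₗ[ℝ] (wordsLE α k × d × d → ℂ) where
  toFun G x := gramCoeff G x.1 x.2.1 x.2.2
  map_add' G G' := by
    ext x
    simp [gramCoeff, ← Finset.sum_add_distrib, ite_add_zero]
  map_smul' c G := by
    ext x
    simp [gramCoeff, Finset.mul_sum]

theorem continuous_gramLinear [Finite α] [DecidableEq α] (D k : ℕ) :
    Continuous (gramLinear (α := α) (d := d) D k) := by
  refine continuous_pi fun x => ?_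
  change Continuous fun G : Matrix (wordsLE α D × d) (wordsLE α D × d) ℂ =>
    ∑ u : wordsLE α D, ∑ v : wordsLE α D,
    if u.1.reverse ++ v.1 = x.1 then G (u, x.2.1) (v, x.2.2) else 0
  refine continuous_finsetSum _ fun u _ => continuous_finsetSum _ fun v _ => ?_
  split_ifs
  · exact continuous_id.matrix_elem _ _
  · exact continuous_const

theorem convex_posSemidef_trace_eq_one {ι : Type*} [Fintype ι] :
    Convex ℝ {G : Matrix ι ι ℂ | G.PosSemidef ∧ G.trace = 1} := by
  rintro G ⟨hG, hG1⟩ G' ⟨hG', hG1'⟩ s t hs ht hst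
  refine ⟨(hG.smul hs).add (hG'.smul ht), ?_⟩
  rw [Matrix.trace_add, Matrix.trace_smul, Matrix.trace_smul, hG1, hG1', ← add_smul, hst, one_smul]

theorem exists_eq_conjTranspose_mul_self {ι : Type*} [Fintype ι] [DecidableEq ι]
    {G : Matrix ι ι ℂ} (hG : G.PosSemidef) : ∃ R : Matrix ι ι ℂ, G = Rᴴ * R := by
  open scoped MatrixOrder in
  exact CStarAlgebra.nonneg_iff_eq_star_mul_self.mp hG.nonneg

theorem isCompact_posSemidef_trace_eq_one {ι : Type*} [Fintype ι] [DecidableEq ι] :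
    IsCompact {G : Matrix ι ι ℂ | G.PosSemidef ∧ G.trace = 1} := by
  have htr : ∀ R : Matrix ι ι ℂ, (Rᴴ * R).trace = ((∑ j, ∑ i, ‖R i j‖ ^ 2 : ℝ) : ℂ) := by
    intro R
    simp [Matrix.trace, Matrix.mul_apply, ← Complex.normSq_eq_conj_mul_self,
      Complex.normSq_eq_norm_sq]
  have hc : Continuous fun R : ι → ι → ℂ => (Matrix.of R)ᴴ * Matrix.of R :=
    (continuous_id.matrix_conjTranspose).matrix_mul continuous_id
  have hS : IsCompact {R : ι → ι → ℂ | ((Matrix.of R)ᴴ * Matrix.of R).trace = 1} := by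
    refine Metric.isCompact_of_isClosed_isBounded
      (isClosed_eq hc.matrix_trace continuous_const) ?_
    refine isBounded_iff_forall_norm_le.2 ⟨1, fun R hR => ?_⟩
    have h1 : ∑ j, ∑ i, ‖R i j‖ ^ 2 = 1 := by
      have := htr (Matrix.of R)
      rw [hR] at this
      exact_mod_cast this.symm
    refine (pi_norm_le_iff_of_nonneg zero_le_one).2 fun i =>
      (pi_norm_le_iff_of_nonneg zero_le_one).2 fun j => ?_
    have h2 : ‖R i j‖ ^ 2 ≤ 1 := by
      rw [← h1]
      refine le_trans ?_ (Finset.single_le_sum (f := fun j => ∑ i, ‖R i j‖ ^ 2)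
        (fun j _ => by positivity) (Finset.mem_univ j))
      exact Finset.single_le_sum (f := fun i => ‖R i j‖ ^ 2)
        (fun i _ => by positivity) (Finset.mem_univ i)
    exact (sq_le_one_iff₀ (norm_nonneg _)).1 h2
  convert hS.image hc using 1
  ext G
  constructor
  · rintro ⟨hG, hG1⟩
    obtain ⟨R, rfl⟩ := exists_eq_conjTranspose_mul_self hG
    exact ⟨R, hG1, rfl⟩
  · rintro ⟨R, hR, rfl⟩
    exact ⟨Matrix.posSemidef_conjTranspose_mul_self _, hR⟩

theorem gramCoeff_eq_zero_of_length [Finite α] [DecidableEq α] {D : ℕ}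
    (G : Matrix (wordsLE α D × d) (wordsLE α D × d) ℂ) {w : List α} (hw : 2 * D < w.length) :
    gramCoeff G w = 0 := by
  ext a b
  simp only [gramCoeff, Matrix.of_apply, Matrix.zero_apply]
  refine Finset.sum_eq_zero fun u _ => Finset.sum_eq_zero fun v _ => if_neg ?_
  rintro rfl
  have hu := mem_wordsLE.1 u.2
  have hv := mem_wordsLE.1 v.2
  simp at hw
  omega

theorem eq_zero_of_gramCoeff_eq_zero [Finite α] [DecidableEq α] [Fintype d] {D : ℕ}
    {R : Matrix N (wordsLE α D × d) ℂ} (h : ∀ w, gramCoeff (Rᴴ * R) w = 0) : R = 0 := by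
  by_contra hR
  have hne : ∃ v, colPoly R v ≠ 0 := by
    by_contra! h0
    refine hR ?_
    ext k ⟨v, b⟩
    simpa [colPoly] using congrFun (congrFun (h0 v) k) b
  obtain ⟨u, -, -, hu⟩ := exists_sqCoeff_ne_zero (fun _ : List α => 0) (by simp) (by simp)
    ((List.finite_length_le α D).subset fun v hv => colPoly_ne_zero hv) hne
  exact hu (by rw [← gramCoeff_conjTranspose_mul_self, h])

/-- The Hankel matrix of the functional with moments `M`. -/
def hankel [Finite α] (D : ℕ) (M : List α → Matrix d d ℂ) :
    Matrix (wordsLE α D × d) (wordsLE α D × d) ℂ :=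
  Matrix.of fun p q => M (p.1.1.reverse ++ q.1.1) p.2 q.2

theorem sum_mul_gramCoeff [Finite α] [DecidableEq α] [Fintype d] {D : ℕ}
    (M : List α → Matrix d d ℂ) (g : wordsLE α D × d → ℂ) :
    ∑ w ∈ wordsLE α (2 * D), ∑ a, ∑ b, M w a b * gramCoeff (Matrix.vecMulVec (star g) g) w a b =
      star g ⬝ᵥ (hankel D M *ᵥ g) := by
  have : ∀ w ∈ wordsLE α (2 * D), ∑ a, ∑ b, M w a b * gramCoeff (Matrix.vecMulVec (star g) g) w a b =
      ∑ u : wordsLE α D, ∑ v : wordsLE α D, if u.1.reverse ++ v.1 = w then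
        ∑ a, ∑ b, star (g (u, a)) * (M (u.1.reverse ++ v.1) a b * g (v, b)) else 0 := by
    intro w _
    simp only [gramCoeff, Matrix.of_apply, Finset.mul_sum]
    simp_rw [Finset.sum_comm (s := (Finset.univ : Finset d))
      (t := (Finset.univ : Finset (wordsLE α D)))]
    refine Finset.sum_congr rfl fun u _ => Finset.sum_congr rfl fun v _ => ?_
    split_ifs with h
    · subst h
      refine Finset.sum_congr rfl fun a _ => Finset.sum_congr rfl fun b _ => ?_
      simp [Matrix.vecMulVec_apply]
      ring
    · simp
  rw [Finset.sum_congr rfl this, Finset.sum_comm]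
  simp_rw [dotProduct, Matrix.mulVec, dotProduct, Fintype.sum_prod_type, Finset.mul_sum]
  refine Finset.sum_congr rfl fun u _ => ?_
  rw [Finset.sum_comm, Finset.sum_comm (s := (Finset.univ : Finset d))]
  refine Finset.sum_congr rfl fun v _ => ?_
  rw [Finset.sum_ite_eq, if_pos]
  · rfl
  · have hu := mem_wordsLE.1 u.2
    have hv := mem_wordsLE.1 v.2
    rw [mem_wordsLE, List.length_append, List.length_reverse]
    omega

theorem gramCoeff_reverse [Finite α] [DecidableEq α] {D : ℕ}
    {G : Matrix (wordsLE α D × d) (wordsLE α D × d) ℂ} (hG : G.IsHermitian) (w : List α) :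
    gramCoeff G w.reverse = (gramCoeff G w)ᴴ := by
  ext a b
  simp only [gramCoeff, Matrix.conjTranspose_apply, Matrix.of_apply, star_sum]
  rw [Finset.sum_comm]
  refine Finset.sum_congr rfl fun u _ => Finset.sum_congr rfl fun v _ => ?_
  have : v.1.reverse ++ u.1 = w.reverse ↔ u.1.reverse ++ v.1 = w := by
    rw [← List.reverse_inj]
    simp
  rw [apply_ite star, star_zero, hG.apply]
  simp only [this]

theorem re_sum_symm_mul [Finite α] [Fintype d] {k : ℕ} (M e : List α → Matrix d d ℂ)
    (he : ∀ w, e w.reverse = (e w)ᴴ) :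
    (∑ w ∈ wordsLE α k, ∑ a, ∑ b, ((1 / 2 : ℂ) • (M w + (M w.reverse)ᴴ)) a b * e w a b).re =
      (∑ w ∈ wordsLE α k, ∑ a, ∑ b, M w a b * e w a b).re := by
  have h : ∑ w ∈ wordsLE α k, ∑ a, ∑ b, (M w.reverse)ᴴ a b * e w a b =
      star (∑ w ∈ wordsLE α k, ∑ a, ∑ b, M w a b * e w a b) := by
    rw [star_sum]
    refine Finset.sum_nbij' List.reverse List.reverse (by simp [mem_wordsLE])
      (by simp [mem_wordsLE]) (by simp) (by simp) fun w _ => ?_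
    rw [star_sum, Finset.sum_comm]
    refine Finset.sum_congr rfl fun a _ => ?_
    rw [star_sum]
    refine Finset.sum_congr rfl fun b _ => ?_
    rw [he]
    simp
  have h2 : ∑ w ∈ wordsLE α k, ∑ a, ∑ b, ((1 / 2 : ℂ) • (M w + (M w.reverse)ᴴ)) a b * e w a b =
      (1 / 2 : ℂ) * (∑ w ∈ wordsLE α k, ∑ a, ∑ b, M w a b * e w a b +
        ∑ w ∈ wordsLE α k, ∑ a, ∑ b, (M w.reverse)ᴴ a b * e w a b) := by
    simp only [← Finset.sum_add_distrib, Finset.mul_sum]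
    refine Finset.sum_congr rfl fun w _ => Finset.sum_congr rfl fun a _ =>
      Finset.sum_congr rfl fun b _ => ?_
    simp only [Matrix.smul_apply, Matrix.add_apply, smul_eq_mul]
    ring
  rw [h2, h]
  simp
  ring

theorem exists_moments [Finite α] [DecidableEq α] [Fintype d] [DecidableEq d] {D : ℕ}
    {f : List α → Matrix d d ℂ} (hlen : ∀ w, f w ≠ 0 → w.length ≤ 2 * D)
    (hstar : ∀ w, f w.reverse = (f w)ᴴ)
    (hf : ¬ ∃ R : Matrix (wordsLE α D × d) (wordsLE α D × d) ℂ, ∀ w, f w = sqCoeff (colPoly R) w) :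
    ∃ M : List α → Matrix d d ℂ, (∀ w, M w.reverse = (M w)ᴴ) ∧ (hankel D M).PosDef ∧
      (∑ w ∈ wordsLE α (2 * D), ∑ a, ∑ b, M w a b * f w a b).re < 0 := by
  set F : wordsLE α (2 * D) × d × d → ℂ := fun x => f x.1 x.2.1 x.2.2 with hF
  have hrep : ∀ R : Matrix (wordsLE α D × d) (wordsLE α D × d) ℂ,
      gramLinear D (2 * D) (Rᴴ * R) = F → ∀ w, f w = sqCoeff (colPoly R) w := by
    intro R hR w
    rw [← gramCoeff_conjTranspose_mul_self]
    by_cases hw : w ∈ wordsLE α (2 * D)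
    · ext a b
      exact (congrFun hR (⟨w, hw⟩, a, b)).symm
    · rw [gramCoeff_eq_zero_of_length _ (by simpa [mem_wordsLE] using hw)]
      by_contra h
      exact hw (mem_wordsLE.2 (hlen w h))
  have hF0 : F ≠ 0 := fun h => hf ⟨0, hrep 0 (by simp [h])⟩
  obtain ⟨l, hlpos, hlneg⟩ := exists_pos_on_compact_neg_at
    (isCompact_posSemidef_trace_eq_one.image (continuous_gramLinear (α := α) (d := d) D (2 * D)))
    (convex_posSemidef_trace_eq_one.linear_image _) hF0 (by
      rintro s hs ⟨G, ⟨hG, hG1⟩, hGF⟩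
      obtain ⟨R, rfl⟩ := exists_eq_conjTranspose_mul_self hG
      rcases hs.eq_or_lt with rfl | hs
      · have hR : R = 0 := eq_zero_of_gramCoeff_eq_zero fun w => by
          by_cases hw : w ∈ wordsLE α (2 * D)
          · ext a b
            exact (congrFun hGF (⟨w, hw⟩, a, b)).trans (by simp)
          · exact gramCoeff_eq_zero_of_length _ (by simpa [mem_wordsLE] using hw)
        simp [hR] at hG1
      · refine hf ⟨√s⁻¹ • R, hrep _ ?_⟩
        have : (√s⁻¹ • R)ᴴ * (√s⁻¹ • R) = s⁻¹ • (Rᴴ * R) := by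
          rw [Matrix.conjTranspose_smul, Matrix.smul_mul, Matrix.mul_smul, smul_smul]
          rw [star_trivial, Real.mul_self_sqrt (inv_nonneg.2 hs.le)]
        rw [this, map_smul, hGF, smul_smul, inv_mul_cancel₀ hs.ne', one_smul])
  obtain ⟨m, hm⟩ := exists_re_sum_mul_eq l
  set m' : List α → Matrix d d ℂ := fun w =>
    if h : w ∈ wordsLE α (2 * D) then Matrix.of fun a b => m (⟨w, h⟩, a, b) else 0 with hm'
  have hpair : ∀ e : List α → Matrix d d ℂ,
      (∑ w ∈ wordsLE α (2 * D), ∑ a, ∑ b, m' w a b * e w a b).re =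
        l fun x => e x.1 x.2.1 x.2.2 := by
    intro e
    rw [hm, ← Finset.sum_coe_sort]
    simp [hm', Fintype.sum_prod_type]
  set M : List α → Matrix d d ℂ := fun w => (1 / 2 : ℂ) • (m' w + (m' w.reverse)ᴴ) with hM
  have hMstar : ∀ w, M w.reverse = (M w)ᴴ := by
    intro w
    simp only [hM]
    rw [Matrix.conjTranspose_smul, Matrix.conjTranspose_add, Matrix.conjTranspose_conjTranspose,
      List.reverse_reverse, add_comm]
    simp
  have hherm : (hankel D M).IsHermitian := by
    ext p q
    have := congrFun (congrFun (hMstar (p.1.1.reverse ++ q.1.1)) q.2) p.2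
    simp only [Matrix.conjTranspose_apply, List.reverse_append, List.reverse_reverse] at this
    simp [hankel, this]
  refine ⟨M, hMstar, .of_dotProduct_mulVec_pos hherm fun g hg => ?_, ?_⟩
  · have hG := Matrix.posSemidef_vecMulVec_star_self g
    have htr : (Matrix.vecMulVec (star g) g).trace = ((∑ i, ‖g i‖ ^ 2 : ℝ) : ℂ) := by
      simp [Matrix.trace, Matrix.vecMulVec_apply, ← Complex.normSq_eq_conj_mul_self,
        Complex.normSq_eq_norm_sq]
    set τ : ℝ := ∑ i, ‖g i‖ ^ 2 with hτ
    have hτ0 : 0 < τ := by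
      obtain ⟨i, hi⟩ := Function.ne_iff.1 hg
      exact Finset.sum_pos' (fun i _ => by positivity)
        ⟨i, Finset.mem_univ i, by have := norm_pos_iff.2 hi; positivity⟩
    have h1 := hlpos _ ⟨τ⁻¹ • Matrix.vecMulVec (star g) g,
      ⟨hG.smul (inv_nonneg.2 hτ0.le), by
        rw [Matrix.trace_smul, htr, Complex.real_smul, ← Complex.ofReal_mul,
          inv_mul_cancel₀ hτ0.ne', Complex.ofReal_one]⟩, rfl⟩
    rw [map_smul, map_smul, smul_eq_mul] at h1
    have h2 := pos_of_mul_pos_right h1 (inv_nonneg.2 hτ0.le)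
    have h3 := hpair (gramCoeff (Matrix.vecMulVec (star g) g))
    rw [← re_sum_symm_mul _ _ (gramCoeff_reverse hG.isHermitian), sum_mul_gramCoeff] at h3
    rw [Complex.pos_iff]
    exact ⟨h3 ▸ h2, (hherm.im_star_dotProduct_mulVec_self g).symm⟩
  · rw [re_sum_symm_mul _ _ hstar, hpair]
    exact hlneg

theorem prod_map_eq_conjTranspose {n : Type*} [Fintype n] [DecidableEq n] {Z : α → Matrix n n ℂ}
    (hZ : ∀ i, (Z i).IsHermitian) (w : List α) :
    (w.map Z).prod = (w.reverse.map Z).prodᴴ := by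
  rw [Matrix.conjTranspose_list_prod, List.map_map, List.map_reverse, List.reverse_reverse]
  congr 1
  exact List.map_congr_left fun i _ => (hZ i).eq.symm

theorem exists_tuple_of_hankel_posDef [Finite α] [DecidableEq α] [Fintype d] [DecidableEq d]
    {D : ℕ} {M : List α → Matrix d d ℂ} (hM : ∀ w, M w.reverse = (M w)ᴴ)
    (hpos : (hankel D M).PosDef) :
    ∃ (n : ℕ) (Z : α → Matrix (Fin n) (Fin n) ℂ) (ξ : d → Fin n → ℂ), (∀ i, (Z i).IsHermitian) ∧
      ∀ w ∈ wordsLE α (2 * D), ∀ a b, star (ξ a) ⬝ᵥ ((w.map Z).prod *ᵥ ξ b) = M w a b := by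
  obtain ⟨S₀, hS₀⟩ := exists_eq_conjTranspose_mul_self hpos.posSemidef
  have hu : IsUnit S₀ := by
    have := hpos.isUnit
    rw [hS₀, Matrix.isUnit_iff_isUnit_det, Matrix.det_mul] at this
    rw [Matrix.isUnit_iff_isUnit_det]
    exact isUnit_of_mul_isUnit_right this
  have hdet := (Matrix.isUnit_iff_isUnit_det _).1 hu
  let e := Fintype.equivFin (wordsLE α D × d)
  set S : Matrix (Fin (Fintype.card (wordsLE α D × d))) (wordsLE α D × d) ℂ :=
    S₀.submatrix e.symm id with hS
  set S' : Matrix (wordsLE α D × d) (Fin (Fintype.card (wordsLE α D × d))) ℂ :=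
    S₀⁻¹.submatrix id e.symm with hS'
  have hSS : Sᴴ * S = hankel D M := by
    rw [hS₀, hS, Matrix.conjTranspose_submatrix, Matrix.submatrix_mul_equiv, Matrix.submatrix_id_id]
  have hSS' : S * S' = 1 := by
    rw [hS, hS', ← Matrix.submatrix_mul _ _ _ _ _ Function.bijective_id,
      Matrix.mul_nonsing_inv _ hdet, Matrix.submatrix_one_equiv]
  have hS'S : S' * S = 1 := by
    rw [hS, hS', Matrix.submatrix_mul_equiv, Matrix.nonsing_inv_mul _ hdet, Matrix.submatrix_id_id]
  set T : α → Matrix (wordsLE α D × d) (wordsLE α D × d) ℂ := fun i =>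
    Matrix.of fun p q => M (p.1.1.reverse ++ i :: q.1.1) p.2 q.2 with hT
  have hTherm : ∀ i, (T i).IsHermitian := by
    intro i
    ext p q
    have := congrFun (congrFun (hM (p.1.1.reverse ++ i :: q.1.1)) q.2) p.2
    simp only [Matrix.conjTranspose_apply, List.reverse_append, List.reverse_reverse,
      List.reverse_cons, List.append_assoc, List.singleton_append] at this
    simp [hT, this]
  obtain ⟨Z, hZherm, hstep⟩ : ∃ Z : α → Matrix (Fin (Fintype.card (wordsLE α D × d)))
      (Fin (Fintype.card (wordsLE α D × d))) ℂ, (∀ i, (Z i).IsHermitian) ∧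
      ∀ i (v : wordsLE α D) (hv : i :: v.1 ∈ wordsLE α D) b,
        Z i *ᵥ S.col (v, b) = S.col (⟨i :: v.1, hv⟩, b) := by
    refine ⟨fun i => S'ᴴ * T i * S',
      fun i => Matrix.isHermitian_conjTranspose_mul_mul _ (hTherm i), ?_⟩
    intro i v hv b
    have h1 : (T i).col (v, b) = (hankel D M).col (⟨i :: v.1, hv⟩, b) := by
      ext p
      simp [hT, hankel]
    rw [← Matrix.mulVec_single_one S, Matrix.mulVec_mulVec, Matrix.mul_assoc, hS'S, Matrix.mul_one,
      ← Matrix.mulVec_mulVec, Matrix.mulVec_single_one, h1, ← hSS, ← Matrix.mulVec_single_one,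
      Matrix.mulVec_mulVec, ← Matrix.mul_assoc, ← Matrix.conjTranspose_mul, hSS',
      Matrix.conjTranspose_one, Matrix.one_mul, Matrix.mulVec_single_one]
  have hnil : ([] : List α) ∈ wordsLE α D := mem_wordsLE.2 (by simp)
  have hword : ∀ (v : List α) (hv : v ∈ wordsLE α D) b,
      (v.map Z).prod *ᵥ S.col (⟨[], hnil⟩, b) = S.col (⟨v, hv⟩, b) := by
    intro v
    induction v with
    | nil => simp
    | cons i v ih =>
      intro hv b
      have hv' : v ∈ wordsLE α D := by
        rw [mem_wordsLE] at hv ⊢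
        simp at hv
        omega
      rw [List.map_cons, List.prod_cons, ← Matrix.mulVec_mulVec, ih hv' b]
      exact hstep i ⟨v, hv'⟩ hv b
  refine ⟨_, Z, fun b => S.col (⟨[], hnil⟩, b), hZherm, fun w hw a b => ?_⟩
  rw [mem_wordsLE] at hw
  have hu : (w.take D).reverse ∈ wordsLE α D := by simp [mem_wordsLE]
  have hv : w.drop D ∈ wordsLE α D := by simp [mem_wordsLE]; omega
  conv_lhs => rw [← List.take_append_drop D w]
  rw [List.map_append, List.prod_append, ← Matrix.mulVec_mulVec, hword _ hv,
    prod_map_eq_conjTranspose hZherm (w.take D),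
    Matrix.dotProduct_mulVec, ← Matrix.star_mulVec, hword _ hu]
  have := congrFun (congrFun hSS (⟨_, hu⟩, a)) (⟨_, hv⟩, b)
  rw [Matrix.mul_apply] at this
  simpa [hankel, dotProduct] using this

/-- A matrix-valued free polynomial that is positive semidefinite on all hermitian tuples is a
hermitian square. -/
theorem exists_eq_sqCoeff_of_posSemidef [Finite α] [DecidableEq α] [Fintype d] [DecidableEq d]
    {D : ℕ} (f : List α →₀ Matrix d d ℂ) (hlen : ∀ w, f w ≠ 0 → w.length ≤ 2 * D)
    (hstar : ∀ w, f w.reverse = (f w)ᴴ)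
    (hpos : ∀ (n : ℕ) (Z : α → Matrix (Fin n) (Fin n) ℂ), (∀ i, (Z i).IsHermitian) →
      (f.sum fun w c => Matrix.kroneckerMap (· * ·) c (w.map Z).prod).PosSemidef) :
    ∃ R : Matrix (wordsLE α D × d) (wordsLE α D × d) ℂ, ∀ w, f w = sqCoeff (colPoly R) w := by
  by_contra hf
  obtain ⟨M, hM, hMpos, hMneg⟩ := exists_moments hlen hstar hf
  obtain ⟨n, Z, ξ, hZ, hξ⟩ := exists_tuple_of_hankel_posDef hM hMpos
  have hsum : (f.sum fun w c => Matrix.kroneckerMap (· * ·) c (w.map Z).prod) =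
      ∑ w ∈ wordsLE α (2 * D), Matrix.kroneckerMap (· * ·) (f w) (w.map Z).prod :=
    Finsupp.sum_of_support_subset f
      (fun w hw => mem_wordsLE.2 (hlen w (Finsupp.mem_support_iff.1 hw))) _
      (fun w _ => by ext; simp)
  have h := (hpos n Z hZ).dotProduct_mulVec_nonneg fun x => ξ x.1 x.2
  rw [hsum, Matrix.sum_mulVec, dotProduct_sum] at h
  have key : ∀ w ∈ wordsLE α (2 * D),
      (star fun x : d × Fin n => ξ x.1 x.2) ⬝ᵥ
        (Matrix.kroneckerMap (· * ·) (f w) (w.map Z).prod *ᵥ fun x => ξ x.1 x.2) =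
      ∑ a, ∑ b, M w a b * f w a b := by
    intro w hw
    simp_rw [← hξ w hw, dotProduct, Matrix.mulVec, dotProduct, Fintype.sum_prod_type,
      Finset.mul_sum, Finset.sum_mul]
    refine Finset.sum_congr rfl fun a _ => ?_
    rw [Finset.sum_comm]
    refine Finset.sum_congr rfl fun b _ => Finset.sum_congr rfl fun k _ =>
      Finset.sum_congr rfl fun j _ => ?_
    simp
    ring
  rw [Finset.sum_congr rfl key] at h
  exact absurd (Complex.le_def.1 h).1 (not_le.2 hMneg)

end SumOfSquares

section FreePolynomials

variable {μ : ℕ}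

theorem polyStar_apply {N d : ℕ} (p : NCPoly N d μ) (w : FreeWord μ) :
    polyStar p w = (p (FreeMonoid.ofList w.toList.reverse))ᴴ := by
  have hinj : Function.Injective
      (fun w : FreeWord μ => FreeMonoid.ofList w.toList.reverse) := fun u v h => by
    simpa using h
  have := Finsupp.mapDomain_apply hinj (Finsupp.mapRange Matrix.conjTranspose (by simp) p)
    (FreeMonoid.ofList w.toList.reverse)
  simpa [polyStar] using this

theorem polyMul_apply {a b c : ℕ} (p : FreeWord μ →₀ Matrix (Fin a) (Fin b) ℂ)
    (q : FreeWord μ →₀ Matrix (Fin b) (Fin c) ℂ) (w : FreeWord μ) :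
    polyMul p q w = ∑ i ∈ Finset.range (w.toList.length + 1),
      p (FreeMonoid.ofList (w.toList.take i)) * q (FreeMonoid.ofList (w.toList.drop i)) := by
  rw [← sum_sum_append_eq (p.support.map FreeMonoid.toList.toEmbedding)
    (q.support.map FreeMonoid.toList.toEmbedding)
    (fun u v => p (FreeMonoid.ofList u) * q (FreeMonoid.ofList v))
    (fun u v hu => by
      have : p (FreeMonoid.ofList u) = 0 := by
        by_contra h
        exact hu (Finset.mem_map.2 ⟨_, Finsupp.mem_support_iff.2 h, rfl⟩)
      rw [this, Matrix.zero_mul])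
    (fun u v hv => by
      have : q (FreeMonoid.ofList v) = 0 := by
        by_contra h
        exact hv (Finset.mem_map.2 ⟨_, Finsupp.mem_support_iff.2 h, rfl⟩)
      rw [this, Matrix.mul_zero])]
  simp only [polyMul, Finsupp.sum, Finset.sum_map, Finsupp.finsetSum_apply]
  refine Finset.sum_congr rfl fun u _ => Finset.sum_congr rfl fun v _ => ?_
  classical
  rw [Finsupp.single_apply]
  exact if_congr Iff.rfl rfl rfl

theorem polyMul_polyStar_self_apply {N d : ℕ} (p : NCPoly N d μ) (w : FreeWord μ) :
    polyMul (polyStar p) p w = sqCoeff (fun u => p (FreeMonoid.ofList u)) w.toList := by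
  rw [polyMul_apply, sqCoeff]
  refine Finset.sum_congr rfl fun i _ => ?_
  rw [polyStar_apply]
  rfl

/-- Letters `aᵢ`, `xⱼ` together with a second copy `hⱼ` of the `x` variables. -/
abbrev DirLetter (μ : ℕ) := (Fin μ ⊕ Fin μ) ⊕ Fin μ

/-- Substitute `xⱼ` for `hⱼ`. -/
def collapse : DirLetter μ → Fin μ ⊕ Fin μ := Sum.elim id Sum.inr

/-- Substitute `hⱼ` for `xⱼ`. -/
def toDir : Fin μ ⊕ Fin μ → DirLetter μ := Sum.elim (Sum.inl ∘ Sum.inl) Sum.inr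

theorem collapse_comp_toDir : collapse ∘ toDir = (id : Fin μ ⊕ Fin μ → _) := by
  ext (i | j) <;> rfl

/-- The number of letters `xⱼ`. -/
def xCount (w : List (Fin μ ⊕ Fin μ)) : ℕ := w.countP Sum.isRight

/-- The degree in `h`. -/
def hDeg (v : List (DirLetter μ)) : ℕ := v.countP Sum.isRight

/-- The degree in `x`. -/
def xDeg (v : List (DirLetter μ)) : ℕ := v.countP (Sum.elim Sum.isRight fun _ => false)

theorem degX_eq_xCount (w : FreeWord μ) : degX w = xCount w.toList :=
  List.countP_eq_length_filter.symm

theorem hDeg_append (u v : List (DirLetter μ)) : hDeg (u ++ v) = hDeg u + hDeg v :=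
  List.countP_append

theorem xDeg_append (u v : List (DirLetter μ)) : xDeg (u ++ v) = xDeg u + xDeg v :=
  List.countP_append

theorem hDeg_reverse (u : List (DirLetter μ)) : hDeg u.reverse = hDeg u := List.countP_reverse

theorem xDeg_reverse (u : List (DirLetter μ)) : xDeg u.reverse = xDeg u := List.countP_reverse

theorem xCount_reverse (u : List (Fin μ ⊕ Fin μ)) : xCount u.reverse = xCount u :=
  List.countP_reverse

theorem hDeg_cons_inl (b : Fin μ ⊕ Fin μ) (v : List (DirLetter μ)) :
    hDeg (Sum.inl b :: v) = hDeg v := by simp [hDeg]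

theorem hDeg_cons_inr (j : Fin μ) (v : List (DirLetter μ)) :
    hDeg (Sum.inr j :: v) = hDeg v + 1 := by simp [hDeg, List.countP_cons]

theorem xCount_cons_inl (i : Fin μ) (w : List (Fin μ ⊕ Fin μ)) :
    xCount (Sum.inl i :: w) = xCount w := by simp [xCount]

theorem xCount_cons_inr (j : Fin μ) (w : List (Fin μ ⊕ Fin μ)) :
    xCount (Sum.inr j :: w) = xCount w + 1 := by simp [xCount, List.countP_cons]

theorem xCount_map_collapse (v : List (DirLetter μ)) :
    xCount (v.map collapse) = hDeg v + xDeg v := by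
  induction v with
  | nil => rfl
  | cons b v ih =>
    rcases b with (i | j) | j <;>
      simp_all [xCount, hDeg, xDeg, collapse, List.countP_cons] <;> omega

theorem hDeg_map_toDir (w : List (Fin μ ⊕ Fin μ)) : hDeg (w.map toDir) = xCount w := by
  induction w with
  | nil => rfl
  | cons b w ih =>
    rcases b with i | j
    · rw [xCount_cons_inl, ← ih]
      exact hDeg_cons_inl _ _
    · rw [xCount_cons_inr, ← ih]
      exact hDeg_cons_inr _ _

theorem hDeg_map_inl (w : List (Fin μ ⊕ Fin μ)) : hDeg (w.map Sum.inl) = 0 := by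
  simp [hDeg]

theorem xDeg_map_inl (w : List (Fin μ ⊕ Fin μ)) : xDeg (w.map Sum.inl) = xCount w := by
  simp [xDeg, xCount, List.countP_map]

theorem exists_append_map_inl (w : List (Fin μ ⊕ Fin μ)) (n : ℕ) (hn : n ≤ xCount w) :
    ∃ (s : List (DirLetter μ)) (u : List (Fin μ ⊕ Fin μ)),
      (s ++ u.map Sum.inl).map collapse = w ∧ hDeg s = n ∧ xCount u + n = xCount w := by
  induction w generalizing n with
  | nil => exact ⟨[], [], rfl, (Nat.le_zero.1 hn).symm, (Nat.zero_add n).trans (Nat.le_zero.1 hn)⟩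
  | cons b w ih =>
    rcases n.eq_zero_or_pos with rfl | hn0
    · refine ⟨[], b :: w, ?_, rfl, rfl⟩
      rw [List.nil_append, List.map_map]
      exact List.map_id _
    · rcases b with i | j
      · rw [xCount_cons_inl] at hn ⊢
        obtain ⟨s, u, h1, h2, h3⟩ := ih n hn
        refine ⟨Sum.inl (Sum.inl i) :: s, u, ?_, ?_, h3⟩
        · rw [List.cons_append, List.map_cons, h1]
          rfl
        · rw [hDeg_cons_inl, h2]
      · rw [xCount_cons_inr] at hn ⊢
        obtain ⟨s, u, h1, h2, h3⟩ := ih (n - 1) (by omega)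
        refine ⟨Sum.inr j :: s, u, ?_, ?_, by omega⟩
        · rw [List.cons_append, List.map_cons, h1]
          rfl
        · rw [hDeg_cons_inr, h2]
          omega

/-- The words obtained from `w` by replacing some letters `xⱼ` by `hⱼ`. -/
def dirWords : List (Fin μ ⊕ Fin μ) → Finset (List (DirLetter μ))
  | [] => {[]}
  | Sum.inl i :: w => (dirWords w).map ⟨List.cons (Sum.inl (Sum.inl i)), List.cons_injective⟩
  | Sum.inr j :: w => (dirWords w).map ⟨List.cons (Sum.inl (Sum.inr j)), List.cons_injective⟩ ∪
      (dirWords w).map ⟨List.cons (Sum.inr j), List.cons_injective⟩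

theorem mem_dirWords {w : List (Fin μ ⊕ Fin μ)} {v : List (DirLetter μ)} :
    v ∈ dirWords w ↔ v.map collapse = w := by
  induction w generalizing v with
  | nil => simp [dirWords]
  | cons b w ih =>
    rcases v with _ | ⟨(i | j) | j, v⟩ <;> rcases b with i' | j' <;>
      simp [dirWords, ih, collapse, and_comm] <;> exact fun _ => eq_comm

theorem sum_dirWords {n : ℕ} (Z : DirLetter μ → Matrix (Fin n) (Fin n) ℂ) (s : ℂ)
    (w : List (Fin μ ⊕ Fin μ)) :
    ∑ v ∈ dirWords w, s ^ hDeg v • (v.map Z).prod =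
      (w.map (Sum.elim (fun i => Z (Sum.inl (Sum.inl i)))
        fun j => Z (Sum.inl (Sum.inr j)) + s • Z (Sum.inr j))).prod := by
  induction w with
  | nil => simp [dirWords, hDeg]
  | cons b w ih =>
    rcases b with i | j
    · simp [dirWords, hDeg_cons_inl, ← ih, Finset.mul_sum]
    · rw [dirWords, Finset.sum_union]
      · simp [hDeg_cons_inl, hDeg_cons_inr, ← ih, Finset.mul_sum, add_mul, pow_succ, smul_smul, mul_comm,
          Finset.sum_add_distrib]
      · rw [Finset.disjoint_left]
        simp only [Finset.mem_map, Function.Embedding.coeFn_mk]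
        rintro _ ⟨a, -, rfl⟩ ⟨b, -, h⟩
        simp at h

/-- The weight of a word of degree `k` in `h` in the second difference of a polynomial. -/
noncomputable def secondDiffWeight (k : ℕ) : ℂ := 2⁻¹ * 1 ^ k + 2⁻¹ * (-1) ^ k - 0 ^ k

/-- The second difference `(p(a,x+h) + p(a,x-h))/2 - p(a,x)`. -/
noncomputable def secondDiff {d : ℕ} (p : NCPoly d d μ) :
    List (DirLetter μ) →₀ Matrix (Fin d) (Fin d) ℂ :=
  Finsupp.onFinset (p.support.biUnion fun w => dirWords w.toList)
    (fun v => secondDiffWeight (hDeg v) • p (FreeMonoid.ofList (v.map collapse)))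
    (fun v hv => Finset.mem_biUnion.2 ⟨FreeMonoid.ofList (v.map collapse),
      Finsupp.mem_support_iff.2 (right_ne_zero_of_smul hv), mem_dirWords.2 rfl⟩)

theorem secondDiff_apply {d : ℕ} (p : NCPoly d d μ) (v : List (DirLetter μ)) :
    secondDiff p v = secondDiffWeight (hDeg v) • p (FreeMonoid.ofList (v.map collapse)) := rfl

theorem secondDiff_apply_of_hDeg_eq_zero {d : ℕ} (p : NCPoly d d μ) {v : List (DirLetter μ)}
    (hv : hDeg v = 0) : secondDiff p v = 0 := by
  rw [secondDiff_apply, hv, secondDiffWeight]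
  norm_num

theorem secondDiff_apply_of_hDeg_eq_two {d : ℕ} (p : NCPoly d d μ) {v : List (DirLetter μ)}
    (hv : hDeg v = 2) : secondDiff p v = p (FreeMonoid.ofList (v.map collapse)) := by
  rw [secondDiff_apply, hv, secondDiffWeight]
  norm_num

theorem secondDiff_reverse {d : ℕ} {p : NCPoly d d μ} (hp : polyStar p = p)
    (v : List (DirLetter μ)) : secondDiff p v.reverse = (secondDiff p v)ᴴ := by
  have h := polyStar_apply p (FreeMonoid.ofList (v.map collapse).reverse)
  rw [hp] at h
  rw [secondDiff_apply, secondDiff_apply, hDeg_reverse, List.map_reverse, h,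
    Matrix.conjTranspose_smul]
  simp [secondDiffWeight]

theorem sum_secondDiff {d n : ℕ} (p : NCPoly d d μ)
    (Z : DirLetter μ → Matrix (Fin n) (Fin n) ℂ) :
    ((secondDiff p).sum fun v c => Matrix.kroneckerMap (· * ·) c (v.map Z).prod) =
      (2⁻¹ : ℂ) • polyEval p (fun i => Z (Sum.inl (Sum.inl i)))
        (fun j => Z (Sum.inl (Sum.inr j)) + (1 : ℂ) • Z (Sum.inr j)) +
      (2⁻¹ : ℂ) • polyEval p (fun i => Z (Sum.inl (Sum.inl i)))
        (fun j => Z (Sum.inl (Sum.inr j)) + (-1 : ℂ) • Z (Sum.inr j)) -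
      polyEval p (fun i => Z (Sum.inl (Sum.inl i)))
        (fun j => Z (Sum.inl (Sum.inr j)) + (0 : ℂ) • Z (Sum.inr j)) := by
  rw [secondDiff, Finsupp.onFinset_sum _ (fun v => by ext; simp), Finset.sum_biUnion]
  · simp only [polyEval, Finsupp.sum, Finset.smul_sum, ← Finset.sum_add_distrib,
      ← Finset.sum_sub_distrib, wordEval]
    refine Finset.sum_congr rfl fun w _ => ?_
    simp only [← sum_dirWords]
    ext x y
    simp only [Matrix.sum_apply, Matrix.sub_apply, Matrix.add_apply, Matrix.smul_apply,
      Matrix.kroneckerMap_apply, smul_eq_mul, Finset.mul_sum, ← Finset.sum_add_distrib,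
      ← Finset.sum_sub_distrib]
    refine Finset.sum_congr rfl fun v hv => ?_
    rw [mem_dirWords.1 hv, secondDiffWeight]
    simp
    ring
  · intro w _ w' _ hne
    rw [Function.onFun, Finset.disjoint_left]
    intro v hv hv'
    rw [mem_dirWords] at hv hv'
    exact hne (FreeMonoid.toList.injective (hv.symm.trans hv'))

theorem posSemidef_sum_secondDiff {d : ℕ} {p : NCPoly d d μ} (hconv : IsConvexInX p) (n : ℕ)
    (Z : DirLetter μ → Matrix (Fin n) (Fin n) ℂ) (hZ : ∀ i, (Z i).IsHermitian) :
    ((secondDiff p).sum fun v c => Matrix.kroneckerMap (· * ·) c (v.map Z).prod).PosSemidef := by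
  have h := hconv n (fun i => Z (Sum.inl (Sum.inl i)))
    (fun j => Z (Sum.inl (Sum.inr j)) + (1 : ℂ) • Z (Sum.inr j))
    (fun j => Z (Sum.inl (Sum.inr j)) + (-1 : ℂ) • Z (Sum.inr j)) (fun i => hZ _)
    (fun j => by simpa using (hZ _).add (hZ _))
    (fun j => by simpa [← sub_eq_add_neg] using (hZ _).sub (hZ _)) 2⁻¹ (by norm_num) (by norm_num)
  rw [sum_secondDiff]
  rw [loewnerLE] at h
  convert h using 2
  · congr 1 <;> ext x y <;> simp <;> norm_num
  · congr 1
    ext j x y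
    simp
    ring

theorem sqCoeff_map {α β N d : Type*} [Fintype N] (g : α → β) (r : List β → Matrix N d ℂ)
    (w : List α) : sqCoeff r (w.map g) = sqCoeff (fun u => r (u.map g)) w := by
  simp [sqCoeff, List.map_take, List.map_drop, List.map_reverse]

theorem exists_of_sqCoeff_ne_zero {α N d : Type*} [Fintype N] {r : List α → Matrix N d ℂ}
    {w : List α} (h : sqCoeff r w ≠ 0) :
    ∃ u v, u.reverse ++ v = w ∧ r u ≠ 0 ∧ r v ≠ 0 := by
  obtain ⟨i, -, hi⟩ := Finset.exists_ne_zero_of_sum_ne_zero h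
  exact ⟨(w.take i).reverse, w.drop i, by simp, fun h0 => hi (by simp [h0]),
    fun h0 => hi (by simp [h0])⟩

/-- The second-order part in `h` of the second difference of a convex polynomial is a hermitian
square of a polynomial that is homogeneous of degree one in `h`. -/
theorem exists_sqCoeff_eq_of_isConvexInX {d : ℕ} {p : NCPoly d d μ} (hherm : polyStar p = p)
    (hconv : IsConvexInX p) :
    ∃ (D : ℕ) (r : List (DirLetter μ) → Matrix (wordsLE (DirLetter μ) D × Fin d) (Fin d) ℂ),
      (∀ v, r v ≠ 0 → v.length ≤ D ∧ hDeg v = 1) ∧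
      ∀ v, hDeg v = 2 → sqCoeff r v = p (FreeMonoid.ofList (v.map collapse)) := by
  set D := p.support.sup fun w => w.toList.length with hD
  obtain ⟨R, hR⟩ := exists_eq_sqCoeff_of_posSemidef (D := D) (secondDiff p)
    (fun v hv => by
      have h1 := Finset.le_sup (f := fun w : FreeWord μ => w.toList.length)
        (Finsupp.mem_support_iff.2 (right_ne_zero_of_smul (secondDiff_apply p v ▸ hv)))
      simp only [FreeMonoid.toList_ofList, List.length_map] at h1
      omega)
    (secondDiff_reverse hherm) (posSemidef_sum_secondDiff hconv)
  have hfin : ∀ P : List (DirLetter μ) → Prop, {v | P v ∧ colPoly R v ≠ 0}.Finite := fun P =>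
    (List.finite_length_le _ D).subset fun v hv => colPoly_ne_zero hv.2
  have h0 : ∀ v, hDeg v = 0 → colPoly R v = 0 := by
    by_contra! hne
    obtain ⟨v, hv, hne⟩ := hne
    set r₀ : List (DirLetter μ) → Matrix (wordsLE (DirLetter μ) D × Fin d) (Fin d) ℂ :=
      fun v => if hDeg v = 0 then colPoly R v else 0 with hr₀
    obtain ⟨u, hu, -, hsq⟩ := exists_sqCoeff_ne_zero (r := r₀) (fun _ => 0) (by simp) (by simp)
      ((hfin fun v => hDeg v = 0).subset fun v hv => by simpa [hr₀] using hv)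
      ⟨v, by simpa [hr₀, hv] using hne⟩
    have hu0 : hDeg u = 0 := by
      by_contra h
      simp [hr₀, h] at hu
    have hw : hDeg (u.reverse ++ u) = 0 := by rw [hDeg_append, hDeg_reverse, hu0]
    refine hsq ?_
    rw [← secondDiff_apply_of_hDeg_eq_zero p hw, hR]
    refine Finset.sum_congr rfl fun i _ => ?_
    rw [← List.take_append_drop i (u.reverse ++ u), hDeg_append] at hw
    simp only [hr₀]
    rw [if_pos (by rw [hDeg_reverse]; omega), if_pos (by omega)]
  refine ⟨D, fun v => if hDeg v = 1 then colPoly R v else 0, fun v hv => ?_, fun v hv => ?_⟩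
  · by_cases h : hDeg v = 1
    · exact ⟨colPoly_ne_zero (by simpa [h] using hv), h⟩
    · simp [h] at hv
  · rw [← secondDiff_apply_of_hDeg_eq_two p hv, hR]
    refine Finset.sum_congr rfl fun i _ => ?_
    have hsum : hDeg (v.take i).reverse + hDeg (v.drop i) = 2 := by
      rw [hDeg_reverse, ← hDeg_append, List.take_append_drop, hv]
    beta_reduce
    by_cases h1 : hDeg (v.take i).reverse = 1
    · rw [if_pos h1, if_pos (by omega)]
    · rw [if_neg h1, Matrix.conjTranspose_zero, Matrix.zero_mul]
      by_cases h2 : hDeg (v.take i).reverse = 0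
      · rw [h0 _ h2, Matrix.conjTranspose_zero, Matrix.zero_mul]
      · rw [h0 (v.drop i) (by omega), Matrix.mul_zero]

theorem degX_le_two_of_sqCoeff_eq {d : ℕ} {p : NCPoly d d μ} {N : Type*} [Fintype N]
    {r : List (DirLetter μ) → Matrix N (Fin d) ℂ} (hfin : {v | r v ≠ 0}.Finite)
    (hr : ∀ v, r v ≠ 0 → hDeg v = 1)
    (hrp : ∀ v, hDeg v = 2 → sqCoeff r v = p (FreeMonoid.ofList (v.map collapse)))
    (w : FreeWord μ) (hw : p w ≠ 0) : degX w ≤ 2 := by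
  obtain ⟨w₀, hw₀, hmax⟩ := Finset.exists_max_image p.support degX
    ⟨w, Finsupp.mem_support_iff.2 hw⟩
  refine (hmax w (Finsupp.mem_support_iff.2 hw)).trans ?_
  by_contra! h3
  rw [degX_eq_xCount] at h3
  obtain ⟨s, u, hsu, hs, hu⟩ := exists_append_map_inl w₀.toList 2 h3.le
  have h2 : hDeg (s ++ u.map Sum.inl) = 2 := by rw [hDeg_append, hDeg_map_inl, hs]
  have hsq : sqCoeff r (s ++ u.map Sum.inl) ≠ 0 := by
    rw [hrp _ h2, hsu]
    exact Finsupp.mem_support_iff.1 hw₀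
  obtain ⟨t, v, htv, ht, hv⟩ := exists_of_sqCoeff_ne_zero hsq
  have hxv : xCount u ≤ xDeg v := by
    rcases List.append_eq_append_iff.1 htv with ⟨c, -, rfl⟩ | ⟨c, -, hc⟩
    · rw [xDeg_append, xDeg_map_inl]
      omega
    · have h4 := congrArg hDeg hc
      rw [hDeg_map_inl, hDeg_append, hr v hv] at h4
      omega
  obtain ⟨y, hy, hymax, hyy⟩ := exists_sqCoeff_ne_zero xDeg xDeg_append xDeg_reverse hfin ⟨v, hv⟩
  have hy2 : hDeg (y.reverse ++ y) = 2 := by rw [hDeg_append, hDeg_reverse, hr y hy]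
  rw [hrp _ hy2] at hyy
  have h5 := hmax _ (Finsupp.mem_support_iff.2 hyy)
  rw [degX_eq_xCount, degX_eq_xCount, FreeMonoid.toList_ofList, xCount_map_collapse, hy2,
    xDeg_append, xDeg_reverse] at h5
  have h6 := hymax v hv
  omega

end FreePolynomials

/-- If the hermitian `d × d` matrix-valued polynomial `p(a,x)` is convex
in `x`, then `p = L + Λ* Λ` with `L` a hermitian `d × d` polynomial affine linear in `x`
and `Λ` an `N × d` polynomial homogeneous of degree one in `x`; in particular `p` has
degree at most two in `x`. -/
theorem convexInX_implies_representation {d μ : ℕ} (hd : 0 < d) (hμ : 0 < μ)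
    (p : NCPoly d d μ) (hherm : polyStar p = p) (hconv : IsConvexInX p) :
    (∃ L : NCPoly d d μ, polyStar L = L ∧ (∀ w, L w ≠ 0 → degX w ≤ 1) ∧
      ∃ N : ℕ, 0 < N ∧ ∃ Λ : NCPoly N d μ, (∀ w, Λ w ≠ 0 → degX w = 1) ∧
        p = L + polyMul (polyStar Λ) Λ) ∧
    (∀ w, p w ≠ 0 → degX w ≤ 2) := by
  obtain ⟨D, r, hr, hrp⟩ := exists_sqCoeff_eq_of_isConvexInX hherm hconv
  have hdeg := degX_le_two_of_sqCoeff_eq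
    ((List.finite_length_le _ D).subset fun v hv => (hr v hv).1) (fun v hv => (hr v hv).2) hrp
  refine ⟨?_, hdeg⟩
  let e := Fintype.equivFin (wordsLE (DirLetter μ) D × Fin d)
  have hNe : Nonempty (wordsLE (DirLetter μ) D × Fin d) :=
    ⟨⟨[], mem_wordsLE.2 (Nat.zero_le _)⟩, ⟨0, hd⟩⟩
  have hfin : {w : FreeWord μ | w.toList.length ≤ D}.Finite := List.finite_length_le _ D
  let Λ : NCPoly (Fintype.card (wordsLE (DirLetter μ) D × Fin d)) d μ :=
    Finsupp.ofSupportFinite (fun w => (r (w.toList.map toDir)).submatrix e.symm id)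
      (hfin.subset fun w hw => by
        have hne : r (w.toList.map toDir) ≠ 0 := fun h => hw (by simp [h])
        simpa using (hr _ hne).1)
  have hΛ : ∀ w, Λ w = (r (w.toList.map toDir)).submatrix e.symm id := fun w => rfl
  have hsq : ∀ w, polyMul (polyStar Λ) Λ w = sqCoeff r (w.toList.map toDir) := by
    intro w
    rw [polyMul_polyStar_self_apply, sqCoeff_map]
    refine Finset.sum_congr rfl fun i _ => ?_
    beta_reduce
    rw [hΛ, hΛ, Matrix.conjTranspose_submatrix, Matrix.submatrix_mul_equiv,
      Matrix.submatrix_id_id]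
    rfl
  have hsq2 : ∀ w, degX w = 2 → polyMul (polyStar Λ) Λ w = p w := by
    intro w hw
    rw [hsq, hrp _ (by rw [hDeg_map_toDir, ← degX_eq_xCount, hw]), List.map_map,
      collapse_comp_toDir, List.map_id, FreeMonoid.ofList_toList]
  have hsq0 : ∀ w, degX w ≠ 2 → polyMul (polyStar Λ) Λ w = 0 := by
    intro w hw
    rw [hsq]
    by_contra h
    obtain ⟨u, v, huv, hu, hv⟩ := exists_of_sqCoeff_ne_zero h
    have h2 := congrArg hDeg huv
    rw [hDeg_append, hDeg_reverse, (hr u hu).2, (hr v hv).2, hDeg_map_toDir,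
      ← degX_eq_xCount] at h2
    exact hw h2.symm
  have hL : ∀ w, (p - polyMul (polyStar Λ) Λ) w = if degX w ≤ 1 then p w else 0 := by
    intro w
    rw [Finsupp.sub_apply]
    split_ifs with h
    · rw [hsq0 w (by omega), sub_zero]
    · by_cases h2 : degX w = 2
      · rw [hsq2 w h2, sub_self]
      · have : p w = 0 := by
          by_contra hp
          have := hdeg w hp
          omega
        rw [hsq0 w h2, this, sub_zero]
  refine ⟨p - polyMul (polyStar Λ) Λ, ?_, fun w hw => ?_, _, Fintype.card_pos, Λ,
    fun w hw => ?_, (sub_add_cancel _ _).symm⟩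
  · ext1 w
    have h1 : degX (FreeMonoid.ofList w.toList.reverse) = degX w := by
      rw [degX_eq_xCount, degX_eq_xCount, FreeMonoid.toList_ofList, xCount_reverse]
    have h2 := polyStar_apply p w
    rw [hherm] at h2
    rw [polyStar_apply, hL, hL, h1, h2]
    split_ifs
    · rfl
    · exact Matrix.conjTranspose_zero
  · by_contra h
    rw [hL, if_neg h] at hw
    exact hw rfl
  · have hne : r (w.toList.map toDir) ≠ 0 := fun h => hw (by rw [hΛ, h]; rfl)
    rw [degX_eq_xCount, ← hDeg_map_toDir]
    exact (hr _ hne).2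
end

section
/- For a hermitian d×d matrix-valued free polynomial p(a,x) in the freely noncommuting variables a_1,…,a_μ, x_1,…,x_μ, the following are equivalent: (i) p is convex in x; (ii) for every a²-pair ((A,X),V), one has (I_d ⊗ V)* p(A,X) (I_d ⊗ V) ⪰ p(V*(A,X)V); (iii) for every n, every tuple (A,X) ∈ S_n(ℂ^μ)×S_n(ℂ^μ), every positive integer m, all tuples α,δ ∈ S_m(ℂ^μ) and every tuple β of n×m complex matrices β_1,…,β_μ, setting W* = (I_n 0) ∈ M_{n,n+m}(ℂ), R_j = diag(A_j, α_j) ∈ S_{n+m}(ℂ) and S_j = [[X_j, β_j],[β_j*, δ_j]] ∈ S_{n+m}(ℂ) for 1 ≤ j ≤ μ, one has (I_d ⊗ W)* p(R,S) (I_d ⊗ W) ⪰ p(W*(R,S)W). -/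
open Matrix ComplexOrder

section Intertwining

theorem kronId_mul {j k l : Type*} [Fintype k] (d : ℕ) (S : Matrix j k ℂ) (T : Matrix k l ℂ) :
    kronId d (S * T) = kronId d S * kronId d T := by
  have h := Matrix.mul_kronecker_mul (1 : Matrix (Fin d) (Fin d) ℂ)
    (1 : Matrix (Fin d) (Fin d) ℂ) S T
  rw [mul_one] at h
  exact h

theorem kronId_one {k : Type*} [DecidableEq k] (d : ℕ) : kronId d (1 : Matrix k k ℂ) = 1 :=
  Matrix.one_kronecker_one

theorem kronId_conjTranspose {j i : Type*} (d : ℕ) (T : Matrix j i ℂ) :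
    (kronId d T)ᴴ = kronId d Tᴴ := by
  have h := Matrix.conjTranspose_kronecker (1 : Matrix (Fin d) (Fin d) ℂ) T
  rw [conjTranspose_one] at h
  exact h

theorem kronId_add {j i : Type*} (d : ℕ) (S T : Matrix j i ℂ) :
    kronId d (S + T) = kronId d S + kronId d T :=
  Matrix.kronecker_add _ _ _

theorem kronId_smul {j i : Type*} (d : ℕ) (c : ℝ) (T : Matrix j i ℂ) :
    kronId d (c • T) = c • kronId d T :=
  Matrix.kronecker_smul _ _ _

variable {μ : ℕ} {k l : Type*} [Fintype k] [DecidableEq k] [Fintype l] [DecidableEq l]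

theorem wordEval_mul_of_intertwines {A X : Fin μ → Matrix k k ℂ} {B Y : Fin μ → Matrix l l ℂ}
    {T : Matrix k l ℂ} (hA : ∀ i, A i * T = T * B i) (hX : ∀ i, X i * T = T * Y i)
    (w : FreeWord μ) : wordEval A X w * T = T * wordEval B Y w := by
  unfold wordEval
  induction w.toList with
  | nil => simp
  | cons a L ih =>
    have ha : Sum.elim A X a * T = T * Sum.elim B Y a := by
      cases a with
      | inl i => exact hA i
      | inr i => exact hX i
    rw [List.map_cons, List.map_cons, List.prod_cons, List.prod_cons, Matrix.mul_assoc, ih,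
      ← Matrix.mul_assoc, ha, Matrix.mul_assoc]

theorem polyEval_mul_of_intertwines {N d : ℕ} (p : NCPoly N d μ)
    {A X : Fin μ → Matrix k k ℂ} {B Y : Fin μ → Matrix l l ℂ}
    {T : Matrix k l ℂ} (hA : ∀ i, A i * T = T * B i) (hX : ∀ i, X i * T = T * Y i) :
    polyEval p A X * kronId d T = kronId N T * polyEval p B Y := by
  unfold polyEval Finsupp.sum
  rw [Matrix.sum_mul, Matrix.mul_sum]
  refine Finset.sum_congr rfl fun w _ => ?_
  have h₁ := Matrix.mul_kronecker_mul (p w) (1 : Matrix (Fin d) (Fin d) ℂ) (wordEval A X w) T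
  have h₂ := Matrix.mul_kronecker_mul (1 : Matrix (Fin N) (Fin N) ℂ) (p w) T (wordEval B Y w)
  rw [Matrix.mul_one] at h₁
  rw [Matrix.one_mul, ← wordEval_mul_of_intertwines hA hX] at h₂
  exact h₁.symm.trans h₂

theorem compress_polyEval_of_intertwines {d : ℕ} (p : NCPoly d d μ)
    {A X : Fin μ → Matrix k k ℂ} {B Y : Fin μ → Matrix l l ℂ} {T : Matrix k l ℂ}
    (hT : Tᴴ * T = 1) (hA : ∀ i, A i * T = T * B i) (hX : ∀ i, X i * T = T * Y i) :
    (kronId d T)ᴴ * polyEval p A X * kronId d T = polyEval p B Y := by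
  rw [Matrix.mul_assoc, polyEval_mul_of_intertwines p hA hX, ← Matrix.mul_assoc,
    kronId_conjTranspose, ← kronId_mul, hT, kronId_one, Matrix.one_mul]

end Intertwining

/-- In an `a²`-pair the range of `V` is invariant under `A`. -/
theorem mul_eq_mul_compress_of_sq {k l : Type*} [Fintype k] [Fintype l] [DecidableEq l]
    {A : Matrix k k ℂ} (hA : A.IsHermitian) {V : Matrix k l ℂ} (hV : Vᴴ * V = 1)
    (hsq : Vᴴ * (A * A) * V = (Vᴴ * A * V) * (Vᴴ * A * V)) :
    A * V = V * (Vᴴ * A * V) := by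
  rw [← sub_eq_zero, ← Matrix.conjTranspose_mul_self_eq_zero]
  simp only [conjTranspose_sub, conjTranspose_mul, conjTranspose_conjTranspose, hA.eq]
  have h₁ : Vᴴ * (A * V) * Vᴴ * (V * (Vᴴ * A * V)) = (Vᴴ * A * V) * (Vᴴ * A * V) := by
    rw [Matrix.mul_assoc (Vᴴ * (A * V)), ← Matrix.mul_assoc Vᴴ V, hV, Matrix.one_mul]
    simp only [Matrix.mul_assoc]
  rw [Matrix.sub_mul, Matrix.mul_sub, Matrix.mul_sub, h₁]
  simp only [Matrix.mul_assoc] at hsq ⊢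
  rw [hsq]
  abel

/-- The compression inequality along all `a²`-pairs `((A,X),V)`. -/
def CompressesAlongSqPairs {d μ : ℕ} (p : NCPoly d d μ) : Prop :=
  ∀ (n m : ℕ) (A X : Fin μ → Matrix (Fin n) (Fin n) ℂ),
    (∀ i, (A i).IsHermitian) → (∀ i, (X i).IsHermitian) →
    ∀ V : Matrix (Fin n) (Fin m) ℂ, Vᴴ * V = 1 →
    (∀ i, Vᴴ * (A i * A i) * V = (Vᴴ * A i * V) * (Vᴴ * A i * V)) →
    loewnerLE (polyEval p (compress V A) (compress V X))
      ((kronId d V)ᴴ * polyEval p A X * kronId d V)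

/-- The compression inequality along block pairs, where `R` is block diagonal. -/
def CompressesAlongBlockPairs {d μ : ℕ} (p : NCPoly d d μ) : Prop :=
  ∀ (n m : ℕ) (A X : Fin μ → Matrix (Fin n) (Fin n) ℂ)
    (α δ : Fin μ → Matrix (Fin m) (Fin m) ℂ)
    (β : Fin μ → Matrix (Fin n) (Fin m) ℂ),
    (∀ i, (A i).IsHermitian) → (∀ i, (X i).IsHermitian) →
    (∀ i, (α i).IsHermitian) → (∀ i, (δ i).IsHermitian) →
    ∀ (W : Matrix (Fin n ⊕ Fin m) (Fin n) ℂ),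
      W = Matrix.fromRows (1 : Matrix (Fin n) (Fin n) ℂ) (0 : Matrix (Fin m) (Fin n) ℂ) →
    ∀ (R S : Fin μ → Matrix (Fin n ⊕ Fin m) (Fin n ⊕ Fin m) ℂ),
      R = (fun j => Matrix.fromBlocks (A j) 0 0 (α j)) →
      S = (fun j => Matrix.fromBlocks (X j) (β j) (β j)ᴴ (δ j)) →
    loewnerLE (polyEval p (compress W R) (compress W S))
      ((kronId d W)ᴴ * polyEval p R S * kronId d W)

/-- Averaging `X` with its conjugate under the reflection `2VVᴴ - 1`, which commutes with `A`,
makes the range of `V` reducing for `X` without changing its compression. -/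
theorem IsConvexInX.compressesAlongSqPairs {d μ : ℕ} {p : NCPoly d d μ} (hp : IsConvexInX p) :
    CompressesAlongSqPairs p := by
  intro n m A X hA hX V hV hsq
  have hAV : ∀ i, A i * V = V * compress V A i := fun i =>
    mul_eq_mul_compress_of_sq (hA i) hV (hsq i)
  have hVA : ∀ i, Vᴴ * A i = compress V A i * Vᴴ := fun i => by
    have h := congrArg conjTranspose (hAV i)
    simpa [compress, conjTranspose_mul, (hA i).eq, Matrix.mul_assoc] using h
  obtain ⟨J, hJ⟩ : ∃ J : Matrix (Fin n) (Fin n) ℂ, J = V * Vᴴ + V * Vᴴ - 1 := ⟨_, rfl⟩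
  have hJV : J * V = V := by
    rw [hJ, Matrix.sub_mul, Matrix.add_mul, Matrix.mul_assoc, hV]
    simp
  have hJh : Jᴴ = J := by simp [hJ]
  have hVJ : Vᴴ * J = Vᴴ := by simpa [hJh] using congrArg conjTranspose hJV
  have hJJ : J * J = 1 := by
    nth_rw 1 [hJ]
    rw [Matrix.sub_mul, Matrix.add_mul, Matrix.mul_assoc, hVJ, hJ]
    simp
  have hAJ : ∀ i, A i * J = J * A i := fun i => by
    have h : A i * (V * Vᴴ) = V * Vᴴ * A i := by
      rw [← Matrix.mul_assoc, hAV, Matrix.mul_assoc, ← hVA, Matrix.mul_assoc]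
    rw [hJ, Matrix.mul_sub, Matrix.sub_mul, Matrix.mul_add, Matrix.add_mul, h]
    simp
  have hXJ : ∀ i, (J * X i * J).IsHermitian := fun i => by
    simpa [hJh] using Matrix.isHermitian_mul_mul_conjTranspose J (hX i)
  have key := hp n A X (fun i => J * X i * J) hA hX hXJ (1 / 2) (by norm_num) (by norm_num)
  have hQ : (kronId d V)ᴴ * polyEval p A (fun i => J * X i * J) * kronId d V =
      (kronId d V)ᴴ * polyEval p A X * kronId d V := by
    have h := compress_polyEval_of_intertwines p (A := A) (X := X) (B := A)
      (Y := fun i => J * X i * J) (T := J) (by rw [hJh, hJJ]) hAJ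
      (fun i => by rw [← Matrix.mul_assoc, ← Matrix.mul_assoc, hJJ, Matrix.one_mul])
    rw [← h]
    simp only [← Matrix.mul_assoc, kronId_conjTranspose, hJh, ← kronId_mul, hVJ]
    rw [Matrix.mul_assoc _ (kronId d J), ← kronId_mul, hJV]
  have hM : (kronId d V)ᴴ * polyEval p A
      (fun i => (1 / 2 : ℝ) • X i + (1 - 1 / 2 : ℝ) • (J * X i * J)) * kronId d V =
      polyEval p (compress V A) (compress V X) := by
    refine compress_polyEval_of_intertwines p hV hAV fun i => ?_
    have h : (J * X i * J) * V = V * (Vᴴ * X i * V) + V * (Vᴴ * X i * V) - X i * V := by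
      rw [Matrix.mul_assoc, hJV, hJ]
      simp only [Matrix.sub_mul, Matrix.add_mul, Matrix.mul_assoc, Matrix.one_mul]
    rw [Matrix.add_mul, Matrix.smul_mul, Matrix.smul_mul, h, compress]
    module
  have h := key.conjTranspose_mul_mul_same (kronId d V)
  rw [Matrix.mul_sub, Matrix.sub_mul, hM, Matrix.mul_add, Matrix.add_mul, Matrix.mul_smul,
    Matrix.mul_smul, Matrix.smul_mul, Matrix.smul_mul, hQ, ← add_smul] at h
  unfold loewnerLE
  norm_num at h
  exact h

theorem CompressesAlongSqPairs.compressesAlongBlockPairs {d μ : ℕ} {p : NCPoly d d μ}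
    (hp : CompressesAlongSqPairs p) : CompressesAlongBlockPairs p := by
  intro n m A X α δ β hA hX hα hδ W hW R S hR hS
  have hWW : Wᴴ * W = 1 := by
    simp [hW, conjTranspose_fromRows_eq_fromCols_conjTranspose, fromCols_mul_fromRows]
  obtain ⟨T, hT⟩ : ∃ T : Matrix (Fin n ⊕ Fin m) (Fin (n + m)) ℂ,
    T = (1 : Matrix (Fin n ⊕ Fin m) (Fin n ⊕ Fin m) ℂ).submatrix id finSumFinEquiv.symm :=
    ⟨_, rfl⟩
  have hTT : T * Tᴴ = 1 := by
    rw [hT, conjTranspose_submatrix, submatrix_mul_equiv]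
    simp
  have hTT' : Tᴴ * T = 1 := by
    rw [hT, conjTranspose_submatrix, ← submatrix_mul _ _ _ _ _ Function.bijective_id]
    simp
  have hcancel : ∀ {l : Type} (M : Matrix (Fin n ⊕ Fin m) l ℂ), T * (Tᴴ * M) = M := fun M => by
    rw [← Matrix.mul_assoc, hTT, Matrix.one_mul]
  have hRh : ∀ i, (R i).IsHermitian := fun i => by
    rw [hR]
    exact (hA i).fromBlocks (by simp) (hα i)
  have hSh : ∀ i, (S i).IsHermitian := fun i => by
    rw [hS]
    exact (hX i).fromBlocks rfl (hδ i)
  have hTcomp : ∀ M : Matrix (Fin n ⊕ Fin m) (Fin n ⊕ Fin m) ℂ, M * T = T * (Tᴴ * M * T) :=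
    fun M => by rw [Matrix.mul_assoc, hcancel]
  have hcomp : ∀ Z : Fin μ → Matrix (Fin n ⊕ Fin m) (Fin n ⊕ Fin m) ℂ,
      compress (Tᴴ * W) (compress T Z) = compress W Z := fun Z => by
    funext i
    simp only [compress, conjTranspose_mul, conjTranspose_conjTranspose, Matrix.mul_assoc, hcancel]
  have h := hp (n + m) n (compress T R) (compress T S)
    (fun i => Matrix.isHermitian_conjTranspose_mul_mul T (hRh i))
    (fun i => Matrix.isHermitian_conjTranspose_mul_mul T (hSh i)) (Tᴴ * W)
    (by simp only [conjTranspose_mul, conjTranspose_conjTranspose, Matrix.mul_assoc, hcancel, hWW])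
    (fun i => by
      simp only [compress, conjTranspose_mul, conjTranspose_conjTranspose, Matrix.mul_assoc,
        hcancel]
      simp [hR, hW, conjTranspose_fromRows_eq_fromCols_conjTranspose, fromCols_mul_fromRows,
        fromBlocks_mul_fromRows])
  rw [hcomp, hcomp, ← compress_polyEval_of_intertwines p (B := compress T R)
    (Y := compress T S) hTT' (fun i => hTcomp (R i)) (fun i => hTcomp (S i))] at h
  have hW' : kronId d T * kronId d (Tᴴ * W) = kronId d W := by rw [← kronId_mul, hcancel]
  have e : (kronId d (Tᴴ * W))ᴴ * ((kronId d T)ᴴ * polyEval p R S * kronId d T) *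
      kronId d (Tᴴ * W) = (kronId d W)ᴴ * polyEval p R S * kronId d W := by
    rw [← hW', conjTranspose_mul]
    simp only [Matrix.mul_assoc]
  rwa [e] at h

/-- Rotating `diag(X, Y)` by the angle with cosine `√t` gives a block matrix whose corner is
`tX + (1-t)Y`, while `diag(A, A)` is left fixed. -/
theorem CompressesAlongBlockPairs.isConvexInX {d μ : ℕ} {p : NCPoly d d μ}
    (hp : CompressesAlongBlockPairs p) : IsConvexInX p := by
  intro n A X Y hA hX hY t ht₀ ht₁
  obtain ⟨c, hc⟩ : ∃ c : ℝ, c * c = t := ⟨√t, Real.mul_self_sqrt ht₀.le⟩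
  obtain ⟨s, hs⟩ : ∃ s : ℝ, s * s = 1 - t := ⟨√(1 - t), Real.mul_self_sqrt (by linarith)⟩
  have hβ : ∀ i, ((c * s) • (Y i - X i))ᴴ = (c * s) • (Y i - X i) := fun i => by
    simp [conjTranspose_smul, (hX i).eq, (hY i).eq]
  have hlin : ∀ (a b : ℝ) i, (a • X i + b • Y i).IsHermitian := fun a b i => by
    simp [Matrix.IsHermitian, conjTranspose_smul, (hX i).eq, (hY i).eq]
  obtain ⟨W, hW⟩ : ∃ W : Matrix (Fin n ⊕ Fin n) (Fin n) ℂ, W = fromRows 1 0 := ⟨_, rfl⟩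
  obtain ⟨R, hR⟩ : ∃ R : Fin μ → Matrix (Fin n ⊕ Fin n) (Fin n ⊕ Fin n) ℂ,
    R = fun j => fromBlocks (A j) 0 0 (A j) := ⟨_, rfl⟩
  obtain ⟨S, hS⟩ : ∃ S : Fin μ → Matrix (Fin n ⊕ Fin n) (Fin n ⊕ Fin n) ℂ,
    S = fun j => fromBlocks (t • X j + (1 - t) • Y j) ((c * s) • (Y j - X j))
      ((c * s) • (Y j - X j))ᴴ ((1 - t) • X j + t • Y j) := ⟨_, rfl⟩
  have h := hp n n A _ A _ _ hA (hlin t (1 - t)) hA (hlin (1 - t) t) W hW R S hR hS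
  have hRW : compress W R = A := by
    funext i
    simp [compress, hR, hW, conjTranspose_fromRows_eq_fromCols_conjTranspose,
      fromCols_mul_fromRows, Matrix.mul_assoc, fromBlocks_mul_fromRows]
  have hSW : compress W S = fun i => t • X i + (1 - t) • Y i := by
    funext i
    simp [compress, hS, hW, conjTranspose_fromRows_eq_fromCols_conjTranspose,
      fromCols_mul_fromRows, Matrix.mul_assoc, fromBlocks_mul_fromRows]
  obtain ⟨T₁, hT₁⟩ : ∃ T : Matrix (Fin n ⊕ Fin n) (Fin n) ℂ,
    T = fromRows (c • 1) ((-s) • 1) := ⟨_, rfl⟩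
  obtain ⟨T₂, hT₂⟩ : ∃ T : Matrix (Fin n ⊕ Fin n) (Fin n) ℂ,
    T = fromRows (s • 1) (c • 1) := ⟨_, rfl⟩
  have hWT : W = c • T₁ + s • T₂ := by
    ext (i | i) j
    · simp only [hW, hT₁, hT₂, Matrix.add_apply, Matrix.smul_apply, fromRows_apply_inl, smul_smul,
        hc, hs, ← add_smul]
      simp
    · simp only [hW, hT₁, hT₂, Matrix.add_apply, Matrix.smul_apply, fromRows_apply_inr, smul_smul,
        ← add_smul]
      simp [mul_comm]
  have hWT₁ : Wᴴ * T₁ = c • 1 := by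
    simp [hW, hT₁, conjTranspose_fromRows_eq_fromCols_conjTranspose, fromCols_mul_fromRows]
  have hWT₂ : Wᴴ * T₂ = s • 1 := by
    simp [hW, hT₂, conjTranspose_fromRows_eq_fromCols_conjTranspose, fromCols_mul_fromRows]
  have hRT₁ : ∀ i, R i * T₁ = T₁ * A i := fun i => by
    simp [hR, hT₁, fromBlocks_mul_fromRows, fromRows_mul]
  have hRT₂ : ∀ i, R i * T₂ = T₂ * A i := fun i => by
    simp [hR, hT₂, fromBlocks_mul_fromRows, fromRows_mul]
  have hST₁ : ∀ i, S i * T₁ = T₁ * X i := fun i => by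
    simp only [hS, hβ, hT₁, fromBlocks_mul_fromRows, fromRows_mul, Matrix.mul_smul,
      Matrix.smul_mul, Matrix.mul_one, Matrix.one_mul]
    congr 1
    · match_scalars
      · linear_combination c * hs
      · linear_combination -c * hs
    · match_scalars
      · linear_combination s * hc
      · linear_combination -s * hc
  have hST₂ : ∀ i, S i * T₂ = T₂ * Y i := fun i => by
    simp only [hS, hβ, hT₂, fromBlocks_mul_fromRows, fromRows_mul, Matrix.mul_smul,
      Matrix.smul_mul, Matrix.mul_one, Matrix.one_mul]
    congr 1
    · match_scalars
      · linear_combination -s * hc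
      · linear_combination s * hc
    · match_scalars
      · linear_combination c * hs
      · linear_combination -c * hs
  have hsum : (kronId d W)ᴴ * polyEval p R S * kronId d W =
      t • polyEval p A X + (1 - t) • polyEval p A Y := by
    rw [Matrix.mul_assoc]
    nth_rw 2 [hWT]
    rw [kronId_add, kronId_smul, kronId_smul, Matrix.mul_add, Matrix.mul_smul, Matrix.mul_smul,
      polyEval_mul_of_intertwines p hRT₁ hST₁, polyEval_mul_of_intertwines p hRT₂ hST₂,
      Matrix.mul_add, Matrix.mul_smul, Matrix.mul_smul, ← Matrix.mul_assoc, ← Matrix.mul_assoc,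
      kronId_conjTranspose, ← kronId_mul, ← kronId_mul, hWT₁, hWT₂, kronId_smul, kronId_smul,
      kronId_one, Matrix.smul_mul, Matrix.smul_mul, Matrix.one_mul, Matrix.one_mul, smul_smul,
      smul_smul, hc, hs]
  rwa [hRW, hSW, hsum] at h

/-- Alternate formulations of partial convexity: for a hermitian `d × d`
matrix-valued polynomial `p(a,x)` the following are equivalent: (i) `p` is convex in `x`;
(ii) for every `a²`-pair `((A,X),V)` one has `(I⊗V)* p(A,X) (I⊗V) ⪰ p(V*(A,X)V)`;
(iii) the analogous inequality for the special block-form pairs `((R,S),W)`. -/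
theorem partial_convexity_tfae {d μ : ℕ} (hd : 0 < d) (hμ : 0 < μ)
    (p : NCPoly d d μ) (hherm : polyStar p = p) :
    (IsConvexInX p ↔
      -- (ii): a²-pairs
      (∀ (n m : ℕ) (A X : Fin μ → Matrix (Fin n) (Fin n) ℂ),
        (∀ i, (A i).IsHermitian) → (∀ i, (X i).IsHermitian) →
        ∀ V : Matrix (Fin n) (Fin m) ℂ, Vᴴ * V = 1 →
        (∀ i, Vᴴ * (A i * A i) * V = (Vᴴ * A i * V) * (Vᴴ * A i * V)) →
        loewnerLE (polyEval p (compress V A) (compress V X))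
          ((kronId d V)ᴴ * polyEval p A X * kronId d V))) ∧
    (IsConvexInX p ↔
      -- (iii): block-form pairs
      (∀ (n m : ℕ) (A X : Fin μ → Matrix (Fin n) (Fin n) ℂ)
        (α δ : Fin μ → Matrix (Fin m) (Fin m) ℂ)
        (β : Fin μ → Matrix (Fin n) (Fin m) ℂ),
        (∀ i, (A i).IsHermitian) → (∀ i, (X i).IsHermitian) →
        (∀ i, (α i).IsHermitian) → (∀ i, (δ i).IsHermitian) →
        ∀ (W : Matrix (Fin n ⊕ Fin m) (Fin n) ℂ),
          W = Matrix.fromRows (1 : Matrix (Fin n) (Fin n) ℂ) (0 : Matrix (Fin m) (Fin n) ℂ) →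
        ∀ (R S : Fin μ → Matrix (Fin n ⊕ Fin m) (Fin n ⊕ Fin m) ℂ),
          R = (fun j => Matrix.fromBlocks (A j) 0 0 (α j)) →
          S = (fun j => Matrix.fromBlocks (X j) (β j) (β j)ᴴ (δ j)) →
        loewnerLE (polyEval p (compress W R) (compress W S))
          ((kronId d W)ᴴ * polyEval p R S * kronId d W))) := by
  have h₁ : IsConvexInX p → CompressesAlongSqPairs p := IsConvexInX.compressesAlongSqPairs
  have h₂ : CompressesAlongSqPairs p → CompressesAlongBlockPairs p :=
    CompressesAlongSqPairs.compressesAlongBlockPairs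
  have h₃ : CompressesAlongBlockPairs p → IsConvexInX p := CompressesAlongBlockPairs.isConvexInX
  exact ⟨⟨h₁, h₃ ∘ h₂⟩, ⟨h₂ ∘ h₁, h₃⟩⟩
end

section
/- Suppose p(a,x) is a hermitian matrix-valued free polynomial in the freely noncommuting variables a_1,…,a_μ, x_1,…,x_μ. If p is convex in x, then the degree of p in x is at most two. -/
open Matrix ComplexOrder

section PathGraph

variable {α : Type*}

/-- The total weight of the first `k` letters of `L`. -/
def level (f : α → ℕ) (L : List α) (k : ℕ) : ℕ := ((L.take k).map f).sum

lemma level_succ {f : α → ℕ} {L : List α} {k : ℕ} {l : α} (h : L[k]? = some l) :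
    level f L (k + 1) = level f L k + f l := by
  simp [level, List.take_add_one, h]

variable [DecidableEq α]

/-- The weighted adjacency matrix of the edges labelled `l` in the path whose successive edges are
labelled by the letters of `L` and weighted by `c`. -/
def pathMatrix (L : List α) (c : ℕ → ℝ) (l : α) :
    Matrix (Fin (L.length + 1)) (Fin (L.length + 1)) ℂ :=
  Matrix.of fun a b =>
    if L[(a : ℕ)]? = some l ∧ (b : ℕ) = a + 1 then (c a : ℂ)
    else if L[(b : ℕ)]? = some l ∧ (a : ℕ) = b + 1 then (c b : ℂ) else 0

lemma pathMatrix_isHermitian (L : List α) (c : ℕ → ℝ) (l : α) :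
    (pathMatrix L c l).IsHermitian := by
  ext a b
  simp only [pathMatrix, Matrix.conjTranspose_apply, Matrix.of_apply]
  split_ifs <;> first | omega | simp

/-- The product of the adjacency matrices along a word; its entries count weighted walks. -/
def pathProd (L : List α) (c : ℕ → ℝ) (w : List α) :
    Matrix (Fin (L.length + 1)) (Fin (L.length + 1)) ℂ :=
  (w.map (pathMatrix L c)).prod

lemma pathProd_cons (L : List α) (c : ℕ → ℝ) (l : α) (w : List α) (a b) :
    pathProd L c (l :: w) a b = ∑ k, pathMatrix L c l a k * pathProd L c w k b := by
  simp [pathProd, Matrix.mul_apply]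

lemma pathMatrix_eq_zero_or (L : List α) (c : ℕ → ℝ) (l : α) (a b : Fin (L.length + 1)) :
    (L[(a : ℕ)]? = some l ∧ (b : ℕ) = a + 1 ∧ pathMatrix L c l a b = c a) ∨
    (L[(b : ℕ)]? = some l ∧ (a : ℕ) = b + 1 ∧ pathMatrix L c l a b = c b) ∨
    ¬ (L[(a : ℕ)]? = some l ∧ (b : ℕ) = a + 1) ∧ ¬ (L[(b : ℕ)]? = some l ∧ (a : ℕ) = b + 1) ∧
      pathMatrix L c l a b = 0 := by
  simp only [pathMatrix, Matrix.of_apply]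
  split_ifs with h1 h2
  · exact Or.inl ⟨h1.1, h1.2, rfl⟩
  · exact Or.inr (Or.inl ⟨h2.1, h2.2, rfl⟩)
  · exact Or.inr (Or.inr ⟨h1, h2, rfl⟩)

lemma pathProd_eq_zero (f : α → ℕ) (L : List α) (c : ℕ → ℝ) (w : List α)
    (a b : Fin (L.length + 1))
    (h : level f L a + (w.map f).sum < level f L b) : pathProd L c w a b = 0 := by
  induction w generalizing a with
  | nil =>
    have : a ≠ b := by rintro rfl; simp at h
    simp [pathProd, this]
  | cons l w ih =>
    rw [pathProd_cons]
    refine Finset.sum_eq_zero fun k _ => ?_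
    simp only [List.map_cons, List.sum_cons] at h
    rcases pathMatrix_eq_zero_or L c l a k with ⟨h1, h2, -⟩ | ⟨h1, h2, -⟩ | ⟨-, -, h3⟩
    · have := level_succ (f := f) h1
      rw [ih k (by rw [h2]; omega), mul_zero]
    · have := level_succ (f := f) h1
      rw [← h2] at this
      rw [ih k (by omega), mul_zero]
    · rw [h3, zero_mul]

/-- A walk that is too short to visit the edges of level at most one does not see their weights. -/
lemma pathProd_congr {f : α → ℕ} (hf : ∀ l, f l ≤ 1) (L : List α) {c c' : ℕ → ℝ}
    (hc : ∀ k l, L[k]? = some l → f l = 0 ∨ 2 ≤ level f L k → c k = c' k) (w : List α)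
    (a b : Fin (L.length + 1))
    (h : (w.map f).sum + 2 < level f L a + level f L b) :
    pathProd L c w a b = pathProd L c' w a b := by
  induction w generalizing a with
  | nil => rfl
  | cons l w ih =>
    rw [pathProd_cons, pathProd_cons]
    refine Finset.sum_congr rfl fun k _ => ?_
    simp only [List.map_cons, List.sum_cons] at h
    have hl := hf l
    rcases pathMatrix_eq_zero_or L c l a k with ⟨h1, h2, h3⟩ | ⟨h1, h2, h3⟩ | ⟨h1, h2, h3⟩ <;>
    rcases pathMatrix_eq_zero_or L c' l a k with ⟨g1, g2, g3⟩ | ⟨g1, g2, g3⟩ | ⟨g1, g2, g3⟩ <;>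
    first
    | omega
    | (exfalso; tauto)
    | skip
    · have e := level_succ (f := f) h1
      rw [← h2] at e
      by_cases hk : f l = 0 ∨ 2 ≤ level f L a
      · rw [h3, g3, hc _ _ h1 hk, ih k (by omega)]
      · rw [pathProd_eq_zero f L c w k b (by omega), pathProd_eq_zero f L c' w k b (by omega),
          mul_zero, mul_zero]
    · have e := level_succ (f := f) h1
      rw [← h2] at e
      by_cases hk : f l = 0 ∨ 2 ≤ level f L k
      · rw [h3, g3, hc _ _ h1 hk, ih k (by omega)]
      · rw [pathProd_eq_zero f L c w k b (by omega), pathProd_eq_zero f L c' w k b (by omega),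
          mul_zero, mul_zero]
    · rw [h3, g3, zero_mul, zero_mul]

/-- Among words of weight at most the weight of `L`, only `L` itself labels a walk along the whole
path. -/
lemma pathProd_last {f : α → ℕ} (hf : ∀ l, 0 < f l) (L : List α) {c P : ℕ → ℝ}
    (hP : ∀ k < L.length, P k = c k * P (k + 1)) (hP1 : P L.length = 1) (w : List α)
    (a : Fin (L.length + 1))
    (h : level f L a + (w.map f).sum ≤ level f L L.length) :
    pathProd L c w a (Fin.last _) = if w = L.drop a then (P a : ℂ) else 0 := by
  induction w generalizing a with
  | nil =>
    have ha := a.is_lt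
    have h1 : ([] = L.drop a) ↔ a = Fin.last _ := by
      rw [eq_comm, List.drop_eq_nil_iff, Fin.ext_iff, Fin.val_last]; omega
    simp only [h1, pathProd, List.map_nil, List.prod_nil, Matrix.one_apply]
    split_ifs with h2
    · simp [h2, hP1]
    · rfl
  | cons l w ih =>
    rw [pathProd_cons]
    simp only [List.map_cons, List.sum_cons] at h
    have hl := hf l
    have back : ∀ k : Fin (L.length + 1), (k : ℕ) ≠ a + 1 →
        pathMatrix L c l a k * pathProd L c w k (Fin.last _) = 0 := by
      intro k hk
      rcases pathMatrix_eq_zero_or L c l a k with ⟨-, h2, -⟩ | ⟨h1, h2, -⟩ | ⟨-, -, h3⟩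
      · exact absurd h2 hk
      · have := level_succ (f := f) h1
        rw [← h2] at this
        rw [pathProd_eq_zero f, mul_zero]
        rw [Fin.val_last]
        omega
      · rw [h3, zero_mul]
    by_cases hal : L[(a : ℕ)]? = some l
    · obtain ⟨ha, hl'⟩ := List.getElem?_eq_some_iff.1 hal
      rw [Finset.sum_eq_single (⟨a + 1, by omega⟩ : Fin (L.length + 1))
        (fun k _ hk => back k fun e => hk (Fin.ext e)) (by simp)]
      have e := level_succ (f := f) hal
      rw [ih _ (by simp only [e]; omega), List.drop_eq_getElem_cons ha, hl', hP _ ha]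
      simp [pathMatrix, hal]
    · have hne : l :: w ≠ L.drop a := by
        intro e
        apply hal
        have := congrArg (fun t => t[0]?) e
        simpa using this.symm
      rw [if_neg hne]
      refine Finset.sum_eq_zero fun k _ => ?_
      by_cases hk : (k : ℕ) = a + 1
      · rcases pathMatrix_eq_zero_or L c l a k with ⟨h1, -⟩ | ⟨-, h2, -⟩ | ⟨-, -, h3⟩
        · exact absurd h1 hal
        · omega
        · rw [h3, zero_mul]
      · exact back k hk

end PathGraph

/-- A positive semidefinite matrix vanishes in every column through a vanishing diagonal entry. -/
lemma Matrix.PosSemidef.apply_eq_zero_of_diag_eq_zero {k : Type*} [Fintype k] {M : Matrix k k ℂ}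
    (hM : M.PosSemidef) {j : k} (hj : M j j = 0) (i : k) : M i j = 0 := by
  classical
  have h : M *ᵥ Pi.single j 1 = 0 := by
    apply (hM.dotProduct_mulVec_zero_iff _).1
    simp [hj]
  simpa using congrFun h i

/-- Edge weights equal to `s` on the first two letters of positive weight and to `1` elsewhere. -/
def edgeWeight {α : Type*} (f : α → ℕ) (L : List α) (s : ℝ) (k : ℕ) : ℝ :=
  s ^ ((2 - level f L k) - (2 - level f L (k + 1)))

lemma edgeWeight_eq_one {α : Type*} {f : α → ℕ} {L : List α} {k : ℕ} {l : α}
    (hk : L[k]? = some l) (h : f l = 0 ∨ 2 ≤ level f L k) (s : ℝ) : edgeWeight f L s k = 1 := by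
  have e := level_succ (f := f) hk
  rw [edgeWeight, show (2 - level f L k) - (2 - level f L (k + 1)) = 0 by omega, pow_zero]

lemma edgeWeight_zero_eq_midpoint {α : Type*} {f : α → ℕ} {L : List α} {k : ℕ} {l : α}
    (hk : L[k]? = some l) (hf : f l ≤ 1) :
    (1 / 2 : ℝ) * edgeWeight f L 1 k + (1 - 1 / 2) * edgeWeight f L (-1) k =
      edgeWeight f L 0 k := by
  have e := level_succ (f := f) hk
  by_cases h : f l = 0 ∨ 2 ≤ level f L k
  · simp only [edgeWeight_eq_one hk h]; norm_num
  · simp only [edgeWeight, show (2 - level f L k) - (2 - level f L (k + 1)) = 1 by omega]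
    norm_num

lemma pathMatrix_edgeWeight_midpoint {α : Type*} [DecidableEq α] {f : α → ℕ} (L : List α) {l : α}
    (hf : f l ≤ 1) :
    (1 / 2 : ℝ) • pathMatrix L (edgeWeight f L 1) l +
      (1 - 1 / 2 : ℝ) • pathMatrix L (edgeWeight f L (-1)) l =
      pathMatrix L (edgeWeight f L 0) l := by
  ext a b
  simp only [Matrix.add_apply, Matrix.smul_apply, pathMatrix, Matrix.of_apply]
  split_ifs with h1 h2
  · rw [← edgeWeight_zero_eq_midpoint h1.1 hf]; simp
  · rw [← edgeWeight_zero_eq_midpoint h2.1 hf]; simp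
  · simp

lemma pathMatrix_edgeWeight_const {α : Type*} [DecidableEq α] {f : α → ℕ} (L : List α) {l : α}
    (hf : f l = 0) (s s' : ℝ) :
    pathMatrix L (edgeWeight f L s) l = pathMatrix L (edgeWeight f L s') l := by
  ext a b
  simp only [pathMatrix, Matrix.of_apply]
  split_ifs with h1 h2
  · rw [edgeWeight_eq_one h1.1 (.inl hf), edgeWeight_eq_one h1.1 (.inl hf)]
  · rw [edgeWeight_eq_one h2.1 (.inl hf), edgeWeight_eq_one h2.1 (.inl hf)]
  · rfl

lemma pow_level_eq_edgeWeight_mul {α : Type*} (f : α → ℕ) (L : List α) (s : ℝ) {k : ℕ}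
    (hk : k < L.length) :
    s ^ (2 - level f L k) = edgeWeight f L s k * s ^ (2 - level f L (k + 1)) := by
  have e := level_succ (f := f) (List.getElem?_eq_getElem hk)
  rw [edgeWeight, ← pow_add]
  congr 1
  omega

lemma polyEval_apply {N d μ : ℕ} {k : Type*} [Fintype k] [DecidableEq k]
    (p : NCPoly N d μ) (X Y : Fin μ → Matrix k k ℂ) (i j) :
    polyEval p X Y i j = ∑ w ∈ p.support, p w i.1 j.1 * wordEval X Y w i.2 j.2 := by
  simp [polyEval, Finsupp.sum, Matrix.sum_apply, Matrix.kroneckerMap_apply]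

lemma degX_eq_sum {μ : ℕ} (w : FreeWord μ) :
    degX w = (w.toList.map (Sum.elim (fun _ => 0) fun _ => 1)).sum := by
  unfold degX
  induction w.toList with
  | nil => rfl
  | cons l t ih => cases l <;> simp [List.filter_cons, ih, add_comm]

lemma sum_map_elim_one {μ : ℕ} (N : ℕ) (w : FreeWord μ) :
    (w.toList.map (Sum.elim (fun _ => 1) fun _ => N)).sum = N * degX w + degA w := by
  unfold degX degA
  induction w.toList with
  | nil => rfl
  | cons l t ih => cases l <;> simp [List.filter_cons, ih] <;> ring

/-- Some word of maximal degree in `x` also has maximal total weight, for suitable positive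
weights of the letters. -/
lemma exists_maximal_word {N d μ : ℕ} (p : NCPoly N d μ) (hp : p.support.Nonempty) :
    ∃ f : Fin μ ⊕ Fin μ → ℕ, (∀ l, 0 < f l) ∧ ∃ v ∈ p.support, ∀ w ∈ p.support,
      degX w ≤ degX v ∧ (w.toList.map f).sum ≤ (v.toList.map f).sum := by
  set K := p.support.sup degA + 1 with hK
  obtain ⟨v, hv, hmax⟩ := p.support.exists_max_image
    (fun w => (w.toList.map (Sum.elim (fun _ => 1) fun _ => K)).sum) hp
  refine ⟨Sum.elim (fun _ => 1) fun _ => K, ?_, v, hv, fun w hw => ⟨?_, hmax w hw⟩⟩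
  · rintro (_ | _) <;> simp [hK]
  · have h := hmax w hw
    simp only [sum_map_elim_one] at h
    have hvK : degA v < K := Nat.lt_succ_of_le (Finset.le_sup (f := degA) hv)
    by_contra! hlt
    nlinarith [Nat.mul_le_mul_left K (Nat.succ_le_of_lt hlt)]

/-- If the hermitian matrix-valued polynomial `p(a,x)` is convex in `x`,
then the degree of `p` in `x` is at most two. -/
theorem convexInX_implies_degree_at_most_two {d μ : ℕ} (hd : 0 < d) (hμ : 0 < μ)
    (p : NCPoly d d μ) (hherm : polyStar p = p) (hconv : IsConvexInX p) :
    ∀ w, p w ≠ 0 → degX w ≤ 2 := by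
  intro w₀ hw₀
  obtain ⟨f, hf, v, hv, hmax⟩ := exists_maximal_word p ⟨w₀, by simpa using hw₀⟩
  refine (hmax w₀ (by simpa using hw₀)).1.trans ?_
  by_contra! hdeg
  let L := v.toList
  let e : Fin μ ⊕ Fin μ → ℕ := Sum.elim (fun _ => 0) fun _ => 1
  have he : ∀ l, e l ≤ 1 := by rintro (_ | _) <;> simp [e]
  have hlast : level e L L.length = degX v := by simp [level, degX_eq_sum, L, e]
  let T (s : ℝ) := pathMatrix L (edgeWeight e L s)
  let A i := T 0 (Sum.inl i)
  let X (s : ℝ) j := T s (Sum.inr j)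
  have hword : ∀ s w, wordEval A (X s) w = pathProd L (edgeWeight e L s) w.toList := by
    intro s w
    have : Sum.elim A (X s) = T s := by
      funext l
      rcases l with i | j
      · exact pathMatrix_edgeWeight_const L rfl 0 s
      · rfl
    rw [wordEval, this]; rfl
  have hpsd := hconv _ A (X 1) (X (-1)) (fun _ => pathMatrix_isHermitian _ _ _)
    (fun _ => pathMatrix_isHermitian _ _ _) (fun _ => pathMatrix_isHermitian _ _ _)
    (1 / 2) (by norm_num) (by norm_num)
  have hmid : (fun j => (1 / 2 : ℝ) • X 1 j + (1 - 1 / 2 : ℝ) • X (-1) j) = X 0 :=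
    funext fun j => pathMatrix_edgeWeight_midpoint L (he _)
  rw [hmid, loewnerLE] at hpsd
  have hdiag : ∀ β, polyEval p A (X 1) (β, Fin.last _) (β, Fin.last _) =
      polyEval p A (X 0) (β, Fin.last _) (β, Fin.last _) ∧
      polyEval p A (X (-1)) (β, Fin.last _) (β, Fin.last _) =
      polyEval p A (X 0) (β, Fin.last _) (β, Fin.last _) := by
    intro β
    have key : ∀ s, ∀ w ∈ p.support,
        wordEval A (X s) w (Fin.last _) (Fin.last _) =
          wordEval A (X 0) w (Fin.last _) (Fin.last _) := by
      intro s w hw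
      rw [hword, hword]
      refine pathProd_congr he L
        (fun k l hk h => by rw [edgeWeight_eq_one hk h, edgeWeight_eq_one hk h]) _ _ _ ?_
      rw [Fin.val_last, hlast, ← degX_eq_sum]
      have := (hmax w hw).1
      omega
    simp only [polyEval_apply]
    constructor <;> exact Finset.sum_congr rfl fun w hw => by rw [key _ w hw]
  have hcorner : ∀ s α β, polyEval p A (X s) (α, 0) (β, Fin.last _) = p v α β * (s ^ 2 : ℝ) := by
    classical
    intro s α β
    rw [polyEval_apply]
    have key : ∀ w ∈ p.support, wordEval A (X s) w 0 (Fin.last _) =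
        if w = v then ((s ^ 2 : ℝ) : ℂ) else 0 := by
      intro w hw
      rw [hword, pathProd_last hf L (P := fun k => s ^ (2 - level e L k))
        (fun k hk => pow_level_eq_edgeWeight_mul e L s hk)]
      · simp only [L, Fin.val_zero, List.drop_zero, FreeMonoid.toList.injective.eq_iff]
        simp [level]
      · simp only [hlast]
        rw [show 2 - degX v = 0 by omega, pow_zero]
      · simpa [level, L] using (hmax w hw).2
    rw [Finset.sum_congr rfl fun w hw => by rw [key w hw]]
    simp only [mul_ite, mul_zero, Finset.sum_ite_eq', if_pos hv]
  refine Finsupp.mem_support_iff.1 hv (Matrix.ext fun α β => ?_)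
  have hzero := hpsd.apply_eq_zero_of_diag_eq_zero (j := (β, Fin.last _)) (by
    simp only [Matrix.sub_apply, Matrix.add_apply, Matrix.smul_apply, (hdiag β).1, (hdiag β).2]
    simp only [Complex.real_smul]; push_cast; ring) (α, 0)
  simp only [Matrix.sub_apply, Matrix.add_apply, Matrix.smul_apply, hcorner,
    Complex.real_smul] at hzero
  push_cast at hzero
  rw [Matrix.zero_apply]
  linear_combination hzero
end

section
/- Suppose p(a,x) is a hermitian d×d matrix-valued free polynomial in the freely noncommuting variables a_1,…,a_μ, x_1,…,x_μ. If p is convex in a and convex in x (separately), then p has degree at most two in both a and x, and every word w with p_w ≠ 0 is not of the form a_j a_i x_k x_m or x_m x_k a_i a_j; that is, p ∈ M_d(ℂ) ⊗ span(𝓛), where 𝓛 is the set of words in a,x of degree at most two in both a and x excluding those of the forms a_j a_i x_k x_m and x_m x_k a_i a_j. -/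
open Matrix ComplexOrder

/-- `p(a,x)` is convex in `a`: for each `n`, all hermitian tuples `A, B`, each hermitian
tuple `X` and each `0 < t < 1`, `p(tA+(1-t)B, X) ⪯ t p(A,X) + (1-t) p(B,X)`. -/
def IsConvexInA {d μ : ℕ} (p : NCPoly d d μ) : Prop :=
  ∀ (n : ℕ) (A B X : Fin μ → Matrix (Fin n) (Fin n) ℂ),
    (∀ i, (A i).IsHermitian) → (∀ i, (B i).IsHermitian) → (∀ i, (X i).IsHermitian) →
    ∀ t : ℝ, 0 < t → t < 1 →
    loewnerLE (polyEval p (fun i => t • A i + (1 - t) • B i) X)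
      (t • polyEval p A X + (1 - t) • polyEval p B X)

section FockSpace

variable {L k : Type} [Fintype k] [DecidableEq k]

/-- The product of the matrices `C c` along the letters `c` of a list. -/
def listEval (C : L → Matrix k k ℂ) (l : List L) : Matrix k k ℂ := (l.map C).prod

@[simp] theorem listEval_nil (C : L → Matrix k k ℂ) : listEval C [] = 1 := rfl

@[simp] theorem listEval_cons (C : L → Matrix k k ℂ) (c : L) (l : List L) :
    listEval C (c :: l) = C c * listEval C l := by
  simp [listEval]

variable [DecidableEq L]

/-- The sum of the creation and annihilation operators of the letter `c` on the Fock space with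
basis the words of length at most `N`. -/
def fockOp (N : ℕ) (c : L) :
    Matrix {l : List L // l.length ≤ N} {l : List L // l.length ≤ N} ℂ :=
  Matrix.of fun g h => if g.1 = c :: h.1 ∨ h.1 = c :: g.1 then 1 else 0

theorem fockOp_isHermitian (N : ℕ) (c : L) : (fockOp N c).IsHermitian := by
  ext g h
  simp only [fockOp, conjTranspose_apply, of_apply, or_comm]
  split_ifs <;> simp

/-- The vacuum vector of the truncated Fock space. -/
def fockVacuum (L : Type) [DecidableEq L] (N : ℕ) : {l : List L // l.length ≤ N} → ℂ :=
  fun g => if g.1 = [] then 1 else 0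


theorem fock_mulVec_vacuum {N : ℕ} [Fintype {l : List L // l.length ≤ N}] (l : List L)
    (g : {l : List L // l.length ≤ N}) (h : l.length ≤ g.1.length) :
    (listEval (fockOp N) l *ᵥ fockVacuum L N) g = if l = g.1 then 1 else 0 := by
  induction l generalizing g with
  | nil => simp [fockVacuum, eq_comm]
  | cons c l ih =>
    rw [listEval_cons, ← mulVec_mulVec]
    simp only [mulVec, dotProduct] at ih ⊢
    obtain ⟨g, hg⟩ := g
    cases g with
    | nil => simp at h
    | cons a g =>
      have hg' : g.length ≤ N := by simp at hg; omega
      simp only [List.length_cons, add_le_add_iff_right] at h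
      rw [Finset.sum_eq_single ⟨g, hg'⟩]
      · rw [ih _ h]
        simp only [fockOp, of_apply]
        by_cases hac : a = c
        · subst hac; simp
        · have h1 : ¬ (g = c :: a :: g) := fun h => by
            have := congrArg List.length h; simp at this; omega
          have h2 : ¬ (c = a) := fun h => hac h.symm
          simp [hac, h1, h2]
      · rintro ⟨b, hb⟩ - hne
        simp only [fockOp, of_apply]
        split_ifs with hor
        · rcases hor with hor | hor
          · simp only [List.cons.injEq] at hor
            exact absurd (Subtype.ext hor.2.symm) hne
          · rw [ih ⟨b, hb⟩ (by simp [hor]; omega), if_neg, mul_zero]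
            rintro rfl
            simp [hor] at h
        · simp
      · simp

theorem exists_fock_dual_vector {N : ℕ} [Fintype {l : List L // l.length ≤ N}] (r : List L)
    (hr : r.length ≤ N) :
    ∃ φ : {l : List L // l.length ≤ N} → ℂ, ∀ l : List L, l.length ≤ N →
      φ ⬝ᵥ (listEval (fockOp N) l *ᵥ fockVacuum L N) = if l = r then 1 else 0 := by
  induction hn : N - r.length using Nat.strong_induction_on generalizing r with
  | _ n ih =>
  have key : ∀ s : {l : List L // l.length ≤ N}, ∃ φ : {l : List L // l.length ≤ N} → ℂ,
      r.length < s.1.length → ∀ l : List L, l.length ≤ N →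
      φ ⬝ᵥ (listEval (fockOp N) l *ᵥ fockVacuum L N) = if l = s.1 then 1 else 0 := by
    intro s
    by_cases h : r.length < s.1.length
    · obtain ⟨φ, hφ⟩ := ih (N - s.1.length) (by have := s.2; omega) s.1 s.2 rfl
      exact ⟨φ, fun _ => hφ⟩
    · exact ⟨0, fun h' => absurd h' h⟩
  choose φ hφ using key
  refine ⟨Pi.single ⟨r, hr⟩ 1 - ∑ s : {l : List L // l.length ≤ N},
    if r.length < s.1.length then
      (listEval (fockOp N) s.1 *ᵥ fockVacuum L N) ⟨r, hr⟩ • φ s else 0, fun l hl => ?_⟩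
  rw [sub_dotProduct, sum_dotProduct, single_one_dotProduct]
  have hterm : ∀ s : {l : List L // l.length ≤ N},
      ((if r.length < s.1.length then
        (listEval (fockOp N) s.1 *ᵥ fockVacuum L N) ⟨r, hr⟩ • φ s else 0) ⬝ᵥ
        (listEval (fockOp N) l *ᵥ fockVacuum L N)) =
      if s = ⟨l, hl⟩ then (if r.length < l.length then
        (listEval (fockOp N) l *ᵥ fockVacuum L N) ⟨r, hr⟩ else 0) else 0 := by
    rintro ⟨s, hs⟩
    by_cases h : r.length < s.length
    · simp only [h, if_true, smul_dotProduct, hφ ⟨s, hs⟩ h l hl, Subtype.mk.injEq]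
      by_cases hsl : s = l
      · subst hsl; simp [h]
      · simp [hsl, Ne.symm hsl]
    · simp only [h, if_false, zero_dotProduct, Subtype.mk.injEq]
      by_cases hsl : s = l
      · subst hsl; simp [h]
      · simp [hsl]
  simp only [hterm, Finset.sum_ite_eq', Finset.mem_univ, if_true]
  by_cases h : r.length < l.length
  · simp only [h, if_true, sub_self]
    rw [if_neg]
    rintro rfl
    omega
  · rw [fock_mulVec_vacuum l ⟨r, hr⟩ (by simpa using h)]
    simp [h]

end FockSpace

section SecondOrder

variable {L k : Type} [Fintype k] [DecidableEq k]

/-- The coefficient of `t` in `listEval (C + t • D) l`. -/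
def listEval₁ (C D : L → Matrix k k ℂ) : List L → Matrix k k ℂ
  | [] => 0
  | c :: l => D c * listEval C l + C c * listEval₁ C D l

/-- The coefficient of `t ^ 2` in `listEval (C + t • D) l`. -/
def listEval₂ (C D : L → Matrix k k ℂ) : List L → Matrix k k ℂ
  | [] => 0
  | c :: l => D c * listEval₁ C D l + C c * listEval₂ C D l

theorem exists_listEval_expansion (C D : L → Matrix k k ℂ) (l : List L) :
    ∃ R : ℝ → Matrix k k ℂ, Continuous R ∧ ∀ t : ℝ,
      listEval (fun c => C c + (t : ℂ) • D c) l =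
        listEval C l + (t : ℂ) • listEval₁ C D l + ((t : ℂ) ^ 2) • listEval₂ C D l +
          ((t : ℂ) ^ 3) • R t := by
  induction l with
  | nil => exact ⟨0, continuous_zero, by simp [listEval₁, listEval₂]⟩
  | cons c l ih =>
    obtain ⟨R, hR, h⟩ := ih
    refine ⟨fun t => D c * listEval₂ C D l + (C c + (t : ℂ) • D c) * R t, by fun_prop,
      fun t => ?_⟩
    simp only [listEval_cons, h, listEval₁, listEval₂]
    simp only [mul_add, add_mul, smul_mul_assoc, mul_smul_comm, smul_add, smul_smul]
    module

/-- The scalar polynomial `∑ b_l l` has nonnegative second differences, as a quadratic form, in the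
directions `D` supported on the letters satisfying `P`. -/
def MidpointNonneg (S : Finset (List L)) (b : List L → ℂ) (P : L → Bool) : Prop :=
  ∀ (k : Type) [Fintype k] [DecidableEq k] (C D : L → Matrix k k ℂ),
    (∀ c, (C c).IsHermitian) → (∀ c, (D c).IsHermitian) → (∀ c, P c = false → D c = 0) →
    ∀ g : k → ℂ, 0 ≤ ∑ l ∈ S, b l * (star g ⬝ᵥ
      ((1 / 2 : ℂ) • listEval (fun c => C c + D c) l +
        (1 / 2 : ℂ) • listEval (fun c => C c - D c) l - listEval C l) *ᵥ g)

theorem MidpointNonneg.hessian_nonneg {S : Finset (List L)} {b : List L → ℂ} {P : L → Bool}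
    (h : MidpointNonneg S b P) {C D : L → Matrix k k ℂ} (hC : ∀ c, (C c).IsHermitian)
    (hD : ∀ c, (D c).IsHermitian) (hP : ∀ c, P c = false → D c = 0) (g : k → ℂ) :
    0 ≤ ∑ l ∈ S, b l * (star g ⬝ᵥ listEval₂ C D l *ᵥ g) := by
  choose R hR hexp using exists_listEval_expansion C D
  let r : ℝ → ℂ := fun t => ∑ l ∈ S, b l * (star g ⬝ᵥ listEval₂ C D l *ᵥ g) +
    (t : ℂ) * ∑ l ∈ S, b l * (star g ⬝ᵥ ((1 / 2 : ℂ) • R l t - (1 / 2 : ℂ) • R l (-t)) *ᵥ g)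
  have hr : Continuous r := by
    have := hR
    dsimp only [r]
    fun_prop
  have hpos : ∀ t : ℝ, 0 < t → 0 ≤ r t := by
    intro t ht
    have h1 := h k C (fun c => (t : ℂ) • D c) hC
      (fun c => by
        have := hD c
        rw [IsHermitian] at this ⊢
        rw [conjTranspose_smul, this]; simp)
      (fun c hc => by simp [hP c hc]) g
    have h2 : ∑ l ∈ S, b l * (star g ⬝ᵥ
      ((1 / 2 : ℂ) • listEval (fun c => C c + (t : ℂ) • D c) l +
        (1 / 2 : ℂ) • listEval (fun c => C c - (t : ℂ) • D c) l - listEval C l) *ᵥ g) =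
        ((t ^ 2 : ℝ) : ℂ) * r t := by
      have e1 : ∀ l, listEval (fun c => C c - (t : ℂ) • D c) l = listEval C l +
          ((-t : ℝ) : ℂ) • listEval₁ C D l + (((-t : ℝ) : ℂ) ^ 2) • listEval₂ C D l +
          (((-t : ℝ) : ℂ) ^ 3) • R l (-t) := by
        intro l
        rw [← hexp]
        simp [sub_eq_add_neg]
      simp only [r, mul_add, Finset.mul_sum, ← Finset.sum_add_distrib]
      refine Finset.sum_congr rfl fun l _ => ?_
      have e2 : ((1 / 2 : ℂ) • listEval (fun c => C c + (t : ℂ) • D c) l +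
        (1 / 2 : ℂ) • listEval (fun c => C c - (t : ℂ) • D c) l - listEval C l) =
        ((t : ℂ) ^ 2) • (listEval₂ C D l +
          (t : ℂ) • ((1 / 2 : ℂ) • R l t - (1 / 2 : ℂ) • R l (-t))) := by
        rw [hexp, e1]
        push_cast
        module
      rw [e2, smul_mulVec, add_mulVec, smul_mulVec, dotProduct_smul, dotProduct_add,
        dotProduct_smul]
      simp only [smul_eq_mul]
      push_cast
      ring
    rw [h2] at h1
    have ht2 : (0 : ℂ) ≤ (((t ^ 2)⁻¹ : ℝ) : ℂ) := by
      exact_mod_cast (by positivity : (0 : ℝ) ≤ (t ^ 2)⁻¹)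
    have ht3 : (((t ^ 2)⁻¹ : ℝ) : ℂ) * ((t ^ 2 : ℝ) : ℂ) = 1 := by
      rw [← Complex.ofReal_mul, inv_mul_cancel₀ (by positivity), Complex.ofReal_one]
    simpa only [← mul_assoc, ht3, one_mul] using mul_nonneg ht2 h1
  have hlim : Filter.Tendsto r (nhdsWithin 0 (Set.Ioi 0)) (nhds (r 0)) :=
    (hr.tendsto 0).mono_left nhdsWithin_le_nhds
  have h0 : 0 ≤ r 0 := ge_of_tendsto hlim (by
    filter_upwards [self_mem_nhdsWithin] with t ht using hpos t ht)
  simpa [r] using h0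

end SecondOrder
section OffDiagonal

variable {L k : Type} [Fintype k]

/-- The vector `∑ C^v T(c, r)`, over all decompositions `l = v ++ c :: r`. -/
def suffixVec (C : L → Matrix k k ℂ) (T : L → List L → k → ℂ) : List L → k → ℂ
  | [] => 0
  | c :: l => T c l + C c *ᵥ suffixVec C T l

/-- The sum of `⟨T(c, u.reverse ++ r), suffixVec C T' l'⟩` over all decompositions
`l = u ++ c :: l'`. -/
def zipperForm (C : L → Matrix k k ℂ) (T T' : L → List L → k → ℂ) : List L → List L → ℂ
  | _, [] => 0
  | r, c :: l => star (T c r) ⬝ᵥ suffixVec C T' l + zipperForm C T T' (c :: r) l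

theorem suffixVec_add_smul (C : L → Matrix k k ℂ) (s : ℂ) (T T' : L → List L → k → ℂ)
    (l : List L) :
    suffixVec C (fun c r => s • T c r + T' c r) l = s • suffixVec C T l + suffixVec C T' l := by
  induction l with
  | nil => simp [suffixVec]
  | cons c l ih =>
    simp only [suffixVec, ih, mulVec_add, mulVec_smul, smul_add]
    abel

theorem zipperForm_add_smul (C : L → Matrix k k ℂ) (s : ℂ) (T T' : L → List L → k → ℂ)
    (r l : List L) :
    zipperForm C (fun c r => s • T c r + T' c r) (fun c r => s • T c r + T' c r) r l =
      star s * s * zipperForm C T T r l + s * zipperForm C T' T r l +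
        star s * zipperForm C T T' r l + zipperForm C T' T' r l := by
  induction l generalizing r with
  | nil => simp [zipperForm]
  | cons c l ih =>
    simp only [zipperForm, ih, suffixVec_add_smul, star_add, star_smul, add_dotProduct,
      dotProduct_add, smul_dotProduct, dotProduct_smul, smul_eq_mul]
    ring

variable [DecidableEq k]

theorem listEval₁_offDiag_mulVec (C K : L → Matrix k k ℂ) (f : k → ℂ) (l : List L) :
    listEval₁ (fun c => fromBlocks (C c) 0 0 (C c)) (fun c => fromBlocks 0 (K c)ᴴ (K c) 0) l *ᵥ
      Sum.elim f 0 = Sum.elim (0 : k → ℂ) (suffixVec C (fun c r => K c *ᵥ listEval C r *ᵥ f) l) := by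
  have h0 : ∀ l, listEval (fun c => fromBlocks (C c) 0 0 (C c)) l *ᵥ Sum.elim f 0 =
      Sum.elim (listEval C l *ᵥ f) 0 := by
    intro l
    induction l with
    | nil => simp
    | cons c l ih =>
      rw [listEval_cons, ← mulVec_mulVec, ih, fromBlocks_mulVec]
      simp [mulVec_mulVec]
  induction l with
  | nil => ext (i | i) <;> simp [listEval₁, suffixVec]
  | cons c l ih =>
    rw [listEval₁, add_mulVec, ← mulVec_mulVec, ← mulVec_mulVec, ih, h0, fromBlocks_mulVec,
      fromBlocks_mulVec]
    ext (i | i) <;> simp [suffixVec]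

theorem listEval₂_offDiag_form {C : L → Matrix k k ℂ} (hC : ∀ c, (C c).IsHermitian)
    (K : L → Matrix k k ℂ) (f : k → ℂ) (l r : List L) :
    star (Sum.elim (listEval C r *ᵥ f) (0 : k → ℂ)) ⬝ᵥ
      listEval₂ (fun c => fromBlocks (C c) 0 0 (C c)) (fun c => fromBlocks 0 (K c)ᴴ (K c) 0) l *ᵥ
        Sum.elim f 0 =
      zipperForm C (fun c r => K c *ᵥ listEval C r *ᵥ f) (fun c r => K c *ᵥ listEval C r *ᵥ f)
        r l := by
  induction l generalizing r with
  | nil => simp [listEval₂, zipperForm]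
  | cons c l ih =>
    rw [listEval₂, add_mulVec, dotProduct_add, zipperForm, ← ih]
    congr 1
    · rw [← mulVec_mulVec, listEval₁_offDiag_mulVec, fromBlocks_mulVec]
      simp only [star_mulVec, Function.star_sumElim, Sum.elim_comp_inl, Sum.elim_comp_inr,
        zero_mulVec, mulVec_zero, zero_add, add_zero, sumElim_dotProduct_sumElim, dotProduct_zero]
      simp [dotProduct_mulVec]
    · rw [← mulVec_mulVec, dotProduct_mulVec, listEval_cons, ← mulVec_mulVec]
      congr 1
      rw [← star_star (fromBlocks (C c) 0 0 (C c)), star_eq_conjTranspose, ← star_mulVec,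
        star_eq_conjTranspose, fromBlocks_conjTranspose, fromBlocks_mulVec, (hC c).eq]
      simp

variable [DecidableEq L]

theorem suffixVec_rankOne {N : ℕ} (C : L → Matrix k k ℂ) (c₀ : L) (r₀ : List L) (x : k → ℂ)
    {T : L → List L → k → ℂ}
    (hT : ∀ c r, r.length ≤ N → T c r = if c = c₀ ∧ r = r₀ then x else 0)
    (l : List L) (hl : l.length ≤ N) :
    (∀ v, l = v ++ c₀ :: r₀ → suffixVec C T l = listEval C v *ᵥ x) ∧
      ((∀ v, l ≠ v ++ c₀ :: r₀) → suffixVec C T l = 0) := by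
  induction l with
  | nil => simp [suffixVec]
  | cons c l ih =>
    have hl' : l.length ≤ N := by simp at hl; omega
    obtain ⟨h1, h2⟩ := ih hl'
    rw [suffixVec, hT c l hl']
    by_cases h : c = c₀ ∧ l = r₀
    · obtain ⟨rfl, rfl⟩ := h
      have : suffixVec C T l = 0 := h2 fun v hv => by
        have := congrArg List.length hv
        simp only [List.length_append, List.length_cons] at this
        omega
      rw [this]
      refine ⟨fun v hv => ?_, fun hv => absurd rfl (hv [])⟩
      have hv' : v = [] := by
        have := congrArg List.length hv
        simp only [List.length_append, List.length_cons] at this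
        exact List.length_eq_zero_iff.1 (by omega)
      simp [hv']
    · rw [if_neg h, zero_add]
      refine ⟨fun v hv => ?_, fun hv => ?_⟩
      · cases v with
        | nil => exact absurd (by simpa using hv) h
        | cons a v =>
          simp only [List.cons_append, List.cons.injEq] at hv
          obtain ⟨rfl, hv⟩ := hv
          rw [h1 v hv, listEval_cons, mulVec_mulVec]
      · rw [h2 fun v hv' => hv (c :: v) (by simp [hv']), mulVec_zero]

theorem zipperForm_rankOne {N : ℕ} (C : L → Matrix k k ℂ) (c₁ c₂ : L) (r₁ r₂ : List L)
    (x₁ x₂ : k → ℂ) {T₁ T₂ : L → List L → k → ℂ}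
    (hT₁ : ∀ c r, r.length ≤ N → T₁ c r = if c = c₁ ∧ r = r₁ then x₁ else 0)
    (hT₂ : ∀ c r, r.length ≤ N → T₂ c r = if c = c₂ ∧ r = r₂ then x₂ else 0)
    (l r : List L) (hl : r.length + l.length ≤ N) :
    (∀ v, r.reverse ++ l = r₂.reverse ++ c₂ :: (v ++ c₁ :: r₁) → r.length ≤ r₂.length →
        zipperForm C T₂ T₁ r l = star x₂ ⬝ᵥ listEval C v *ᵥ x₁) ∧
      (((∀ v, r.reverse ++ l ≠ r₂.reverse ++ c₂ :: (v ++ c₁ :: r₁)) ∨ r₂.length < r.length) →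
        zipperForm C T₂ T₁ r l = 0) := by
  induction l generalizing r with
  | nil =>
    refine ⟨fun v hv hr => ?_, fun _ => rfl⟩
    have := congrArg List.length hv
    simp at this
    omega
  | cons c l ih =>
    simp only [List.length_cons] at hl
    obtain ⟨h1, h2⟩ := ih (c :: r) (by simp; omega)
    obtain ⟨s1, s2⟩ := suffixVec_rankOne (N := N) C c₁ r₁ x₁ hT₁ l (by omega)
    have happ : (c :: r).reverse ++ l = r.reverse ++ c :: l := by simp
    rw [happ] at h1 h2
    simp only [List.length_cons] at h1 h2
    rw [zipperForm, hT₂ c r (by omega)]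
    by_cases h : c = c₂ ∧ r = r₂
    · obtain ⟨rfl, rfl⟩ := h
      rw [h2 (Or.inr (by omega)), add_zero]
      simp only [List.append_cancel_left_eq, List.cons.injEq, true_and, and_self, if_true, ne_eq,
        lt_self_iff_false, or_false]
      exact ⟨fun v hv _ => by rw [s1 v hv], fun hv => by rw [s2 hv, dotProduct_zero]⟩
    · rw [if_neg h, star_zero, zero_dotProduct, zero_add]
      refine ⟨fun v hv hr => h1 v hv ?_, fun hv => h2 (hv.imp_right (by omega))⟩
      by_contra hlt
      have hlen : r.reverse.length = r₂.reverse.length := by simp; omega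
      obtain ⟨ha, hb⟩ := List.append_inj hv hlen
      exact h ⟨(List.cons.inj hb).1, List.reverse_injective ha⟩

end OffDiagonal
section Coefficients

theorem eq_zero_of_forall_nonneg_mul_add {x γ : ℝ} (h : ∀ t : ℝ, 0 ≤ t * x + γ) : x = 0 := by
  by_contra hx
  have := h (-(γ + 1) / x)
  rw [div_mul_cancel₀ _ hx] at this
  linarith

theorem eq_zero_of_forall_complex_nonneg {β β' γ : ℂ}
    (h : ∀ s : ℂ, 0 ≤ s * β + star s * β' + γ) : β = 0 := by
  simp only [Complex.le_def] at h
  have h1 : β.re + β'.re = 0 := eq_zero_of_forall_nonneg_mul_add (γ := γ.re) fun t => by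
    have := (h t).1
    simp at this
    linarith
  have h2 : -β.im + β'.im = 0 := eq_zero_of_forall_nonneg_mul_add (γ := γ.re) fun t => by
    have := (h (t * Complex.I)).1
    simp at this
    linarith
  have h3 := (h 0).2
  have h4 := (h 1).2
  have h5 := (h Complex.I).2
  simp at h3 h4 h5
  apply Complex.ext <;> simp <;> linarith

variable {L : Type} [DecidableEq L]

theorem MidpointNonneg.coeff_eq_zero [Finite L] {S : Finset (List L)} {b : List L → ℂ}
    {P : L → Bool} (h : MidpointNonneg S b P) {c₁ c₂ : L} (hc₁ : P c₁ = true) (hc₂ : P c₂ = true)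
    {u v w : List L} (hS : u ++ c₂ :: (v ++ c₁ :: w) ∈ S)
    (hdiag : ∀ v', b (w.reverse ++ c₁ :: (v' ++ c₁ :: w)) = 0) :
    b (u ++ c₂ :: (v ++ c₁ :: w)) = 0 := by
  let N := S.sup List.length
  have hN : ∀ l ∈ S, l.length ≤ N := fun l hl => Finset.le_sup hl
  have hW := hN _ hS
  simp only [List.length_append, List.length_cons] at hW
  let _ : Fintype {l : List L // l.length ≤ N} := (List.finite_length_le L N).fintype
  obtain ⟨φ₁, hφ₁⟩ := exists_fock_dual_vector (N := N) w (by omega)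
  obtain ⟨φ₂, hφ₂⟩ := exists_fock_dual_vector (N := N) u.reverse (by simp; omega)
  obtain ⟨φ, hφ⟩ := exists_fock_dual_vector (N := N) v (by omega)
  let C : L → Matrix _ _ ℂ := fockOp N
  let f := fockVacuum L N
  let T₁ : L → List L → _ → ℂ := fun c r => (if c = c₁ then φ₁ ⬝ᵥ (listEval C r *ᵥ f) else 0) • f
  let T₂ : L → List L → _ → ℂ :=
    fun c r => (if c = c₂ then φ₂ ⬝ᵥ (listEval C r *ᵥ f) else 0) • star φ
  have hT₁ : ∀ c r, r.length ≤ N → T₁ c r = if c = c₁ ∧ r = w then f else 0 := by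
    intro c r hr
    simp only [T₁, C, f, hφ₁ r hr]
    by_cases hc : c = c₁ <;> by_cases hrw : r = w <;> simp [hc, hrw]
  have hT₂ : ∀ c r, r.length ≤ N → T₂ c r = if c = c₂ ∧ r = u.reverse then star φ else 0 := by
    intro c r hr
    simp only [T₂, C, f, hφ₂ r hr]
    by_cases hc : c = c₂ <;> by_cases hrw : r = u.reverse <;> simp [hc, hrw]
  have hZ₁ : ∀ l ∈ S, b l * zipperForm C T₁ T₁ [] l = 0 := by
    intro l hl
    by_cases hex : ∃ v', l = w.reverse ++ c₁ :: (v' ++ c₁ :: w)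
    · obtain ⟨v', rfl⟩ := hex
      rw [hdiag, zero_mul]
    · rw [(zipperForm_rankOne C c₁ c₁ w w f f hT₁ hT₁ l [] (by simpa using hN l hl)).2
        (Or.inl fun v' hv' => hex ⟨v', by simpa using hv'⟩), mul_zero]
  have hZ₂ : ∀ l ∈ S, b l * zipperForm C T₂ T₁ [] l =
      if l = u ++ c₂ :: (v ++ c₁ :: w) then b (u ++ c₂ :: (v ++ c₁ :: w)) else 0 := by
    intro l hl
    have hlN := hN l hl
    obtain ⟨z1, z2⟩ := zipperForm_rankOne C c₁ c₂ w u.reverse f (star φ) hT₁ hT₂ l []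
      (by simpa using hlN)
    by_cases hex : ∃ v', l = u ++ c₂ :: (v' ++ c₁ :: w)
    · obtain ⟨v', rfl⟩ := hex
      simp only [List.length_append, List.length_cons] at hlN
      rw [z1 v' (by simp) (by simp), star_star, hφ v' (by omega)]
      by_cases hv : v' = v <;> simp [hv]
    · rw [z2 (Or.inl fun v' hv' => hex ⟨v', by simpa using hv'⟩), if_neg, mul_zero]
      exact fun hl' => hex ⟨v, hl'⟩
  refine eq_zero_of_forall_complex_nonneg (β' := ∑ l ∈ S, b l * zipperForm C T₁ T₂ [] l)
    (γ := ∑ l ∈ S, b l * zipperForm C T₂ T₂ [] l) fun s => ?_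
  let K : L → Matrix {l : List L // l.length ≤ N} {l : List L // l.length ≤ N} ℂ := fun c =>
    (if c = c₁ then s else 0) • vecMulVec f φ₁ + (if c = c₂ then (1 : ℂ) else 0) •
      vecMulVec (star φ) φ₂
  have hK : (fun c r => K c *ᵥ listEval C r *ᵥ f) = fun c r => s • T₁ c r + T₂ c r := by
    ext1 c
    ext1 r
    simp only [K, T₁, T₂, add_mulVec, smul_mulVec, vecMulVec_mulVec, op_smul_eq_smul, smul_smul]
    split_ifs <;> simp
  have hpos := h.hessian_nonneg (C := fun c => fromBlocks (C c) 0 0 (C c))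
    (D := fun c => fromBlocks 0 (K c)ᴴ (K c) 0)
    (fun c => by
      rw [IsHermitian, fromBlocks_conjTranspose, (fockOp_isHermitian N c).eq]; simp [C])
    (fun c => by rw [IsHermitian, fromBlocks_conjTranspose]; simp)
    (fun c hc => by
      have h1 : c ≠ c₁ := by rintro rfl; simp [hc] at hc₁
      have h2 : c ≠ c₂ := by rintro rfl; simp [hc] at hc₂
      simp [K, h1, h2])
    (Sum.elim f 0)
  have hform := fun l => listEval₂_offDiag_form (fockOp_isHermitian N) K f l []
  simp only [listEval_nil, one_mulVec] at hform
  have hsum : ∀ l ∈ S, b l * (star (Sum.elim f 0) ⬝ᵥ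
      listEval₂ (fun c => fromBlocks (C c) 0 0 (C c)) (fun c => fromBlocks 0 (K c)ᴴ (K c) 0) l *ᵥ
        Sum.elim f 0) =
      s * (if l = u ++ c₂ :: (v ++ c₁ :: w) then b (u ++ c₂ :: (v ++ c₁ :: w)) else 0) +
      star s * (b l * zipperForm C T₁ T₂ [] l) + b l * zipperForm C T₂ T₂ [] l := by
    intro l hl
    rw [← hZ₂ l hl]
    have := hform l
    rw [show fockOp N = C from rfl, hK, zipperForm_add_smul] at this
    rw [this]
    linear_combination (star s * s) * hZ₁ l hl
  rw [Finset.sum_congr rfl hsum, Finset.sum_add_distrib, Finset.sum_add_distrib,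
    ← Finset.mul_sum, ← Finset.mul_sum, Finset.sum_ite_eq', if_pos hS] at hpos
  exact hpos

end Coefficients
section Polynomials

theorem kroneckerMap_form {m k : Type} [Fintype m] [Fintype k] (c : Matrix m m ℂ)
    (M : Matrix k k ℂ) (α : m → ℂ) (g : k → ℂ) :
    star (fun i : m × k => α i.1 * g i.2) ⬝ᵥ
        kroneckerMap (· * ·) c M *ᵥ (fun i : m × k => α i.1 * g i.2) =
      (star α ⬝ᵥ c *ᵥ α) * (star g ⬝ᵥ M *ᵥ g) := by
  have h : kroneckerMap (· * ·) c M *ᵥ (fun i : m × k => α i.1 * g i.2) =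
      fun i : m × k => (c *ᵥ α) i.1 * (M *ᵥ g) i.2 := by
    ext ⟨i, j⟩
    simp only [mulVec, dotProduct, kroneckerMap_apply, Fintype.sum_prod_type,
      Finset.sum_mul_sum]
    exact Finset.sum_congr rfl fun _ _ => Finset.sum_congr rfl fun _ _ => by ring
  rw [h]
  simp only [dotProduct, Fintype.sum_prod_type, Finset.sum_mul_sum, Pi.star_apply, star_mul']
  exact Finset.sum_congr rfl fun _ _ => Finset.sum_congr rfl fun _ _ => by ring

theorem Matrix.eq_zero_of_forall_form_eq_zero {m : Type} [Fintype m] [DecidableEq m]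
    {M : Matrix m m ℂ} (h : ∀ α : m → ℂ, star α ⬝ᵥ M *ᵥ α = 0) : M = 0 := by
  have h0 : Matrix.toEuclideanLin Mᴴ = 0 := by
    rw [← inner_map_self_eq_zero]
    intro x
    rw [EuclideanSpace.inner_eq_star_dotProduct]
    simp only [Matrix.ofLp_toLpLin, toLin'_apply, star_mulVec, conjTranspose_conjTranspose]
    rw [dotProduct_comm, ← dotProduct_mulVec]
    exact h _
  simpa using h0

theorem listEval_submatrix {L k n : Type} [Fintype k] [DecidableEq k] [Fintype n] [DecidableEq n]
    (e : n ≃ k) (C : L → Matrix k k ℂ) (l : List L) :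
    listEval (fun c => (C c).submatrix e e) l = (listEval C l).submatrix e e := by
  induction l with
  | nil => simp
  | cons c l ih => rw [listEval_cons, ih, listEval_cons, submatrix_mul_equiv]

theorem submatrix_form {k n : Type} [Fintype k] [Fintype n] (e : n ≃ k) (M : Matrix k k ℂ)
    (g : k → ℂ) : star (g ∘ e) ⬝ᵥ M.submatrix e e *ᵥ (g ∘ e) = star g ⬝ᵥ M *ᵥ g := by
  rw [submatrix_mulVec_equiv, Function.comp_assoc, Equiv.self_comp_symm, Function.comp_id]
  exact e.sum_comp fun i => star g i * (M *ᵥ g) i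

variable {d μ : ℕ}

theorem polyEval_form {k : Type} [Fintype k] [DecidableEq k] (p : NCPoly d d μ)
    (C : Fin μ ⊕ Fin μ → Matrix k k ℂ) (α : Fin d → ℂ) (g : k → ℂ) :
    star (fun i : Fin d × k => α i.1 * g i.2) ⬝ᵥ
        polyEval p (C ∘ Sum.inl) (C ∘ Sum.inr) *ᵥ (fun i : Fin d × k => α i.1 * g i.2) =
      ∑ w ∈ p.support, (star α ⬝ᵥ p w *ᵥ α) * (star g ⬝ᵥ listEval C w.toList *ᵥ g) := by
  rw [polyEval, Finsupp.sum, sum_mulVec, dotProduct_sum]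
  refine Finset.sum_congr rfl fun w _ => ?_
  rw [kroneckerMap_form, wordEval, Sum.elim_comp_inl_inr, listEval]

/-- The polynomial `p`, in the variables `C`, is midpoint convex in the directions supported on the
letters satisfying `P`. -/
def IsMidpointConvex (p : NCPoly d d μ) (P : Fin μ ⊕ Fin μ → Bool) : Prop :=
  ∀ (n : ℕ) (C D : Fin μ ⊕ Fin μ → Matrix (Fin n) (Fin n) ℂ),
    (∀ c, (C c).IsHermitian) → (∀ c, (D c).IsHermitian) → (∀ c, P c = false → D c = 0) →
    loewnerLE (polyEval p (C ∘ Sum.inl) (C ∘ Sum.inr))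
      ((1 / 2 : ℝ) • polyEval p ((fun c => C c + D c) ∘ Sum.inl) ((fun c => C c + D c) ∘ Sum.inr) +
        (1 - 1 / 2 : ℝ) •
          polyEval p ((fun c => C c - D c) ∘ Sum.inl) ((fun c => C c - D c) ∘ Sum.inr))

theorem midpoint_eq {k : Type*} (A B : Matrix k k ℂ) :
    (1 / 2 : ℝ) • (A + B) + (1 - 1 / 2 : ℝ) • (A - B) = A := by
  module

theorem IsConvexInX.isMidpointConvex {p : NCPoly d d μ} (h : IsConvexInX p) :
    IsMidpointConvex p Sum.isRight := by
  intro n C D hC hD hP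
  have h1 : (fun c => C c + D c) ∘ Sum.inl = C ∘ Sum.inl := by
    ext1 i; simp [hP (Sum.inl i) rfl]
  have h2 : (fun c => C c - D c) ∘ Sum.inl = C ∘ Sum.inl := by
    ext1 i; simp [hP (Sum.inl i) rfl]
  rw [h1, h2]
  have := h n (C ∘ Sum.inl) ((fun c => C c + D c) ∘ Sum.inr) ((fun c => C c - D c) ∘ Sum.inr)
    (fun i => hC _) (fun i => (hC _).add (hD _)) (fun i => (hC _).sub (hD _)) (1 / 2)
    (by norm_num) (by norm_num)
  simp only [Function.comp_apply, midpoint_eq] at this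
  exact this

theorem IsConvexInA.isMidpointConvex {p : NCPoly d d μ} (h : IsConvexInA p) :
    IsMidpointConvex p Sum.isLeft := by
  intro n C D hC hD hP
  have h1 : (fun c => C c + D c) ∘ Sum.inr = C ∘ Sum.inr := by
    ext1 i; simp [hP (Sum.inr i) rfl]
  have h2 : (fun c => C c - D c) ∘ Sum.inr = C ∘ Sum.inr := by
    ext1 i; simp [hP (Sum.inr i) rfl]
  rw [h1, h2]
  have := h n ((fun c => C c + D c) ∘ Sum.inl) ((fun c => C c - D c) ∘ Sum.inl) (C ∘ Sum.inr)
    (fun i => (hC _).add (hD _)) (fun i => (hC _).sub (hD _)) (fun i => hC _) (1 / 2)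
    (by norm_num) (by norm_num)
  simp only [Function.comp_apply, midpoint_eq] at this
  exact this

theorem IsMidpointConvex.midpointNonneg {p : NCPoly d d μ} {P : Fin μ ⊕ Fin μ → Bool}
    (h : IsMidpointConvex p P) (α : Fin d → ℂ) :
    MidpointNonneg (p.support.image FreeMonoid.toList)
      (fun l => star α ⬝ᵥ p (FreeMonoid.ofList l) *ᵥ α) P := by
  intro k _ _ C D hC hD hP g
  let e := (Fintype.equivFin k).symm
  have h1 := (h (Fintype.card k) (fun c => (C c).submatrix e e) (fun c => (D c).submatrix e e)
    (fun c => (hC c).submatrix e) (fun c => (hD c).submatrix e)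
    (fun c hc => by simp [hP c hc])).dotProduct_mulVec_nonneg (fun i => α i.1 * (g ∘ e) i.2)
  rw [sub_mulVec, add_mulVec, smul_mulVec, smul_mulVec, dotProduct_sub, dotProduct_add,
    dotProduct_smul, dotProduct_smul, polyEval_form, polyEval_form, polyEval_form] at h1
  have hadd : (fun c => (C c).submatrix e e + (D c).submatrix e e) =
      fun c => (C c + D c).submatrix e e := rfl
  have hsub : (fun c => (C c).submatrix e e - (D c).submatrix e e) =
      fun c => (C c - D c).submatrix e e := rfl
  rw [hadd, hsub] at h1
  simp only [listEval_submatrix, submatrix_form] at h1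
  rw [Finset.sum_image FreeMonoid.toList.injective.injOn]
  refine h1.trans_eq ?_
  rw [Finset.smul_sum, Finset.smul_sum, ← Finset.sum_add_distrib, ← Finset.sum_sub_distrib]
  refine Finset.sum_congr rfl fun w _ => ?_
  simp only [FreeMonoid.ofList_toList, sub_mulVec, add_mulVec, smul_mulVec, dotProduct_sub,
    dotProduct_add, dotProduct_smul, smul_eq_mul, Complex.real_smul]
  push_cast
  ring

/-- A word `u c₂ v c₁ w` in the support of a convex polynomial forces a word of the form
`w* c₁ v' c₁ w` in the support. -/
theorem IsMidpointConvex.exists_symmetric_word {p : NCPoly d d μ} {P : Fin μ ⊕ Fin μ → Bool}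
    (h : IsMidpointConvex p P) {c₁ c₂ : Fin μ ⊕ Fin μ} (hc₁ : P c₁ = true) (hc₂ : P c₂ = true)
    {u v w : List (Fin μ ⊕ Fin μ)}
    (hp : p (FreeMonoid.ofList (u ++ c₂ :: (v ++ c₁ :: w))) ≠ 0) :
    ∃ v', p (FreeMonoid.ofList (w.reverse ++ c₁ :: (v' ++ c₁ :: w))) ≠ 0 := by
  by_contra! hno
  refine hp (Matrix.eq_zero_of_forall_form_eq_zero fun α => ?_)
  refine (h.midpointNonneg α).coeff_eq_zero hc₁ hc₂ ?_ fun v' => by rw [hno v']; simp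
  exact Finset.mem_image.2 ⟨_, Finsupp.mem_support_iff.2 hp, rfl⟩

theorem List.exists_eq_append_of_two_le_countP {β : Type*} (P : β → Bool) (l : List β)
    (h : 2 ≤ l.countP P) :
    ∃ u v w c₁ c₂, l = u ++ c₂ :: (v ++ c₁ :: w) ∧ P c₁ = true ∧ P c₂ = true ∧
      w.countP P + 2 = l.countP P := by
  have one : ∀ l : List β, 1 ≤ l.countP P → ∃ u w c, l = u ++ c :: w ∧ P c = true ∧
      w.countP P + 1 = l.countP P := by
    intro l hl
    induction l with
    | nil => simp at hl
    | cons a l ih =>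
      by_cases ha : P a = true
      · exact ⟨[], l, a, rfl, ha, by simp [ha]⟩
      · obtain ⟨u, w, c, rfl, hc, hw⟩ := ih (by simpa [List.countP_cons, ha] using hl)
        exact ⟨a :: u, w, c, rfl, hc, by rw [List.countP_cons_of_neg ha, hw]⟩
  obtain ⟨u, w, c₂, rfl, hc₂, hw⟩ := one l (by omega)
  obtain ⟨v, w', c₁, rfl, hc₁, hw'⟩ := one w (by omega)
  exact ⟨u, v, w', c₁, c₂, rfl, hc₁, hc₂, by omega⟩

theorem IsMidpointConvex.countP_le_two {p : NCPoly d d μ} {P : Fin μ ⊕ Fin μ → Bool}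
    (h : IsMidpointConvex p P) {w : FreeWord μ} (hw : p w ≠ 0) : w.toList.countP P ≤ 2 := by
  obtain ⟨m, hm, hmax⟩ := p.support.exists_max_image (fun w => w.toList.countP P)
    ⟨w, Finsupp.mem_support_iff.2 hw⟩
  refine (hmax w (Finsupp.mem_support_iff.2 hw)).trans ?_
  by_contra! hlt
  obtain ⟨u, v, r, c₁, c₂, hm', hc₁, hc₂, hr⟩ :=
    List.exists_eq_append_of_two_le_countP P m.toList (by omega)
  have hpm := Finsupp.mem_support_iff.1 hm
  rw [← FreeMonoid.ofList_toList m, hm'] at hpm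
  obtain ⟨v', hv'⟩ := h.exists_symmetric_word hc₁ hc₂ hpm
  have := hmax _ (Finsupp.mem_support_iff.2 hv')
  simp [hc₁] at this
  omega

theorem apply_reverse_ne_zero {p : NCPoly d d μ} (h : polyStar p = p)
    {l : List (Fin μ ⊕ Fin μ)} (hp : p (FreeMonoid.ofList l) ≠ 0) :
    p (FreeMonoid.ofList l.reverse) ≠ 0 := by
  have hinj : Function.Injective
      (fun w : FreeWord μ => FreeMonoid.ofList w.toList.reverse) := fun a b hab =>
    FreeMonoid.toList.injective (List.reverse_injective (FreeMonoid.ofList.injective hab))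
  have : polyStar p (FreeMonoid.ofList l.reverse) = (p (FreeMonoid.ofList l))ᴴ := by
    have := Finsupp.mapDomain_apply hinj
      (Finsupp.mapRange Matrix.conjTranspose (by simp) p) (FreeMonoid.ofList l)
    simpa [polyStar] using this
  rw [← h, this]
  simpa using hp

end Polynomials

/-- If the hermitian `d × d` polynomial `p(a,x)` is convex in `a` and in
`x` separately, then `p` has degree at most two in both `a` and `x` and contains no words
of the form `aⱼaᵢx_kx_m` or `x_mx_ka_ia_j`; that is, `p ∈ M_d(ℂ) ⊗ span 𝓛`. -/
theorem biconvex_word_form {d μ : ℕ} (hd : 0 < d) (hμ : 0 < μ)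
    (p : NCPoly d d μ) (hherm : polyStar p = p)
    (hconva : IsConvexInA p) (hconvx : IsConvexInX p) :
    ∀ w, p w ≠ 0 → degA w ≤ 2 ∧ degX w ≤ 2 ∧
      (∀ i j k l : Fin μ,
        w ≠ FreeMonoid.ofList [Sum.inl j, Sum.inl i, Sum.inr k, Sum.inr l] ∧
        w ≠ FreeMonoid.ofList [Sum.inr l, Sum.inr k, Sum.inl i, Sum.inl j]) := by
  intro w hw
  have ha : ∀ {w : FreeWord μ}, p w ≠ 0 → degA w ≤ 2 := fun {w} hw => by
    rw [degA, ← List.countP_eq_length_filter]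
    exact hconva.isMidpointConvex.countP_le_two hw
  have hx : degX w ≤ 2 := by
    rw [degX, ← List.countP_eq_length_filter]
    exact hconvx.isMidpointConvex.countP_le_two hw
  have hxxaa : ∀ i j k l : Fin μ,
      p (FreeMonoid.ofList [Sum.inr l, Sum.inr k, Sum.inl i, Sum.inl j]) = 0 := by
    intro i j k l
    by_contra hp
    obtain ⟨v', hv'⟩ := hconvx.isMidpointConvex.exists_symmetric_word (c₁ := Sum.inr k)
      (c₂ := Sum.inr l) (u := []) (v := []) (w := [Sum.inl i, Sum.inl j]) rfl rfl hp
    have := ha hv'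
    rw [degA, ← List.countP_eq_length_filter, FreeMonoid.toList_ofList] at this
    simp [List.countP_cons] at this
  refine ⟨ha hw, hx, fun i j k l => ⟨?_, ?_⟩⟩
  · rintro rfl
    exact apply_reverse_ne_zero hherm hw (hxxaa i j k l)
  · rintro rfl
    exact hw (hxxaa i j k l)
end
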